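/- arXiv:1805.10591 — 6 statements merged into one kernel-verified Lean document; each statement's English description precedes it below -/
import Mathlib

section
/- Let S₂ = {μ ∈ ℝ : μ > 0 and sin(1/(2μ)) + (1/(2μ))·cos(1/(2μ)) = 0} (the set of positive solutions of the transcendental equation 1/(2μ) + tan(1/(2μ)) = 0). Then S₂ has a greatest element μ*, and this greatest element satisfies 0.24641 < μ* < 0.24647; in particular μ* < 1/4. -/
open Real

/-- Shifting by a quarter turn and halving the angle expresses `sin x + x * cos x`
through sines of small angles. -/
theorem sin_add_mul_cos_quarter_turn (y : ℝ) :
    Real.sin (π / 2 + y) + (π / 2 + y) * Real.cos (π / 2 + y) =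
      1 - 2 * Real.sin (y / 2) ^ 2 -
        (π / 2 + y) * (2 * Real.sin (y / 2) * (1 - 2 * Real.sin (y / 4) ^ 2)) := by
  have hs : Real.sin (π / 2 + y) = Real.cos y := by rw [add_comm, Real.sin_add_pi_div_two]
  have hc : Real.cos (π / 2 + y) = -Real.sin y := by rw [add_comm, Real.cos_add_pi_div_two]
  have cos_eq (z : ℝ) : Real.cos z = 1 - 2 * Real.sin (z / 2) ^ 2 := by
    rw [← Real.cos_two_mul_eq_one_sub, mul_div_cancel₀ z two_ne_zero]
  have sin_eq : Real.sin y = 2 * Real.sin (y / 2) * Real.cos (y / 2) := by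
    rw [← Real.sin_two_mul, mul_div_cancel₀ y two_ne_zero]
  rw [hs, hc, sin_eq, cos_eq y, cos_eq (y / 2), show y / 2 / 2 = y / 4 by ring]
  ring

theorem sin_add_mul_cos_pos_left :
    0 < Real.sin (π / 2 + 0.45787) + (π / 2 + 0.45787) * Real.cos (π / 2 + 0.45787) := by
  rw [sin_add_mul_cos_quarter_turn]
  have h₁ := abs_le.1 (Real.sin_bound (x := (0.45787 : ℝ) / 2) (by norm_num [abs_of_pos]))
  have h₂ := abs_le.1 (Real.sin_bound (x := (0.45787 : ℝ) / 4) (by norm_num [abs_of_pos]))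
  rw [abs_of_pos (by norm_num)] at h₁ h₂
  have hp := Real.pi_lt_d6
  set s := Real.sin (0.45787 / 2)
  set t := Real.sin (0.45787 / 4)
  have hs₀ : 0.22692 < s := by norm_num at h₁ ⊢; linarith
  have hs₁ : s < 0.226946 := by norm_num at h₁ ⊢; linarith
  have ht₀ : 0.114216 < t := by norm_num at h₂ ⊢; linarith
  have hs : s ^ 2 < 0.226946 ^ 2 := by gcongr
  have ht : 0.114216 ^ 2 < t ^ 2 := by gcongr
  have hm : (π / 2 + 0.45787) * (2 * s * (1 - 2 * t ^ 2)) ≤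
      (3.141593 / 2 + 0.45787) * (2 * 0.226946 * (1 - 2 * 0.114216 ^ 2)) := by
    have : π / 2 + 0.45787 ≤ 3.141593 / 2 + 0.45787 := by linarith
    have : 2 * s * (1 - 2 * t ^ 2) ≤ 2 * 0.226946 * (1 - 2 * 0.114216 ^ 2) := by
      have : 1 - 2 * t ^ 2 ≤ 1 - 2 * 0.114216 ^ 2 := by linarith
      calc 2 * s * (1 - 2 * t ^ 2) ≤ 2 * s * (1 - 2 * 0.114216 ^ 2) := by gcongr
        _ ≤ _ := by
          apply mul_le_mul_of_nonneg_right _ (by norm_num)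
          linarith
    calc _ ≤ (π / 2 + 0.45787) * (2 * 0.226946 * (1 - 2 * 0.114216 ^ 2)) := by
          gcongr
      _ ≤ _ := by
          apply mul_le_mul_of_nonneg_right _ (by norm_num)
          assumption
  norm_num at *
  linarith

theorem sin_add_mul_cos_neg_right :
    Real.sin (π / 2 + 0.4582) + (π / 2 + 0.4582) * Real.cos (π / 2 + 0.4582) < 0 := by
  rw [sin_add_mul_cos_quarter_turn]
  have h₁ := abs_le.1 (Real.sin_bound (x := (0.4582 : ℝ) / 2) (by norm_num [abs_of_pos]))
  have h₂ := abs_le.1 (Real.sin_bound (x := (0.4582 : ℝ) / 4) (by norm_num [abs_of_pos]))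
  rw [abs_of_pos (by norm_num)] at h₁ h₂
  have hp := Real.pi_gt_d6
  set s := Real.sin (0.4582 / 2)
  set t := Real.sin (0.4582 / 4)
  have hs₀ : 0.227089 < s := by norm_num at h₁ ⊢; linarith
  have ht₀ : 0 < t := by norm_num at h₂ ⊢; linarith
  have ht₁ : t < 0.1143 := by norm_num at h₂ ⊢; linarith
  have hs : 0.227089 ^ 2 < s ^ 2 := by gcongr
  have ht : t ^ 2 < 0.1143 ^ 2 := by gcongr
  have hm : (3.141592 / 2 + 0.4582) * (2 * 0.227089 * (1 - 2 * 0.1143 ^ 2)) ≤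
      (π / 2 + 0.4582) * (2 * s * (1 - 2 * t ^ 2)) := by
    have : (1 : ℝ) - 2 * 0.1143 ^ 2 ≤ 1 - 2 * t ^ 2 := by linarith
    gcongr
  norm_num at *
  linarith

/-- `sin x + x * cos x` is positive on `(0, a)` whenever it vanishes at some `a ≤ π`. -/
theorem sin_add_mul_cos_pos_of_lt_zero {a x : ℝ} (ha : a ≤ π)
    (hfa : Real.sin a + a * Real.cos a = 0) (hx : 0 < x) (hxa : x < a) :
    0 < Real.sin x + x * Real.cos x := by
  have hsin : 0 < Real.sin x := Real.sin_pos_of_pos_of_lt_pi hx (hxa.trans_le ha)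
  rcases le_total x (π / 2) with h | h
  · have := Real.cos_nonneg_of_neg_pi_div_two_le_of_le (by linarith) h
    positivity
  · have hcos : Real.cos a < Real.cos x := Real.cos_lt_cos_of_nonneg_of_le_pi hx.le ha hxa
    have hcx : Real.cos x ≤ 0 := Real.cos_nonpos_of_pi_div_two_le_of_le h (by linarith)
    have hsin' : Real.sin a ≤ Real.sin x := by
      rw [← Real.cos_sub_pi_div_two, ← Real.cos_sub_pi_div_two x]
      exact Real.cos_le_cos_of_nonneg_of_le_pi (by linarith) (by linarith) (by linarith)
    nlinarith [mul_nonneg_of_nonpos_of_nonpos hcx (sub_nonpos.2 hxa.le),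
      mul_pos (hx.trans hxa) (sub_pos.2 hcos)]

/-- The set of positive solutions of `1/(2μ) + tan(1/(2μ)) = 0`, written in the
equivalent form `sin(1/(2μ)) + (1/(2μ))·cos(1/(2μ)) = 0`, has a greatest element,
which lies strictly between `0.24641` and `0.24647`; in particular it is `< 1/4`. -/
theorem stmt_0 :
    ∃ μs : ℝ,
      IsGreatest {μ : ℝ | 0 < μ ∧
        Real.sin (1 / (2 * μ)) + (1 / (2 * μ)) * Real.cos (1 / (2 * μ)) = 0} μs ∧
      0.24641 < μs ∧ μs < 0.24647 ∧ μs < 1 / 4 := by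
  obtain ⟨a, ⟨ha₁, ha₂⟩, hfa⟩ : (0 : ℝ) ∈ (fun x ↦ Real.sin x + x * Real.cos x) ''
      Set.Icc (π / 2 + 0.45787) (π / 2 + 0.4582) :=
    intermediate_value_Icc' (by norm_num)
      (by fun_prop) ⟨sin_add_mul_cos_neg_right.le, sin_add_mul_cos_pos_left.le⟩
  have hp := Real.pi_gt_d6
  have hp' := Real.pi_lt_d6
  have hlo : 2.02866 < a := by norm_num at *; linarith
  have hhi : a < 2.029 := by norm_num at *; linarith
  have ha₀ : 0 < a := by norm_num at *; linarith
  have haπ : a ≤ π := by norm_num at *; linarith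
  have hinv : 1 / (2 * (1 / (2 * a))) = a := by field_simp
  have hlt : 1 / (2 * a) < 0.24647 := by
    rw [div_lt_iff₀ (by positivity)]; norm_num at *; linarith
  refine ⟨1 / (2 * a), ⟨⟨by positivity, by rw [hinv]; exact hfa⟩, ?_⟩, ?_, hlt,
    hlt.trans (by norm_num)⟩
  · rintro μ ⟨hμ, hfμ⟩
    by_contra! h
    refine (sin_add_mul_cos_pos_of_lt_zero haπ hfa (by positivity) ?_).ne' hfμ
    rw [div_lt_iff₀ (by positivity)] at h ⊢
    linarith
  · rw [lt_div_iff₀ (by positivity)]; norm_num at *; linarith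
end

section
/- Let E = {μ ∈ ℝ : μ > 0 and 1 + (1/(2μ))·sin(1/μ) − cos(1/μ) = 0} and S₂ = {μ ∈ ℝ : μ > 0 and sin(1/(2μ)) + (1/(2μ))·cos(1/(2μ)) = 0}. If S₂ has a greatest element μ* with μ* > 1/(2π), then E has a greatest element and it equals μ*. (Indeed E = S₂ ∪ {μ > 0 : sin(1/(2μ)) = 0}, and every positive μ with sin(1/(2μ)) = 0 satisfies μ ≤ 1/(2π).) -/
open Real

theorem one_add_mul_sin_sub_cos_factor (μ : ℝ) :
    1 + (1 / (2 * μ)) * Real.sin (1 / μ) - Real.cos (1 / μ) =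
      2 * Real.sin (1 / (2 * μ)) *
        (Real.sin (1 / (2 * μ)) + (1 / (2 * μ)) * Real.cos (1 / (2 * μ))) := by
  have h : 1 / μ = 2 * (1 / (2 * μ)) := by
    rw [one_div, one_div, mul_inv, mul_inv_cancel_left₀ two_ne_zero]
  rw [h, Real.sin_two_mul, Real.cos_two_mul]
  linear_combination (-2) * Real.sin_sq_add_cos_sq (1 / (2 * μ))

theorem le_one_div_two_pi_of_sin_eq_zero {μ : ℝ} (hμ : 0 < μ)
    (h : Real.sin (1 / (2 * μ)) = 0) : μ ≤ 1 / (2 * Real.pi) := by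
  have hx : 0 < 1 / (2 * μ) := by positivity
  have hpi : Real.pi ≤ 1 / (2 * μ) := by
    by_contra! hlt
    exact (Real.sin_pos_of_pos_of_lt_pi hx hlt).ne' h
  rw [le_div_iff₀ (by positivity)] at hpi ⊢
  linarith

theorem one_add_mul_sin_sub_cos_eq_zero_iff (μ : ℝ) :
    1 + (1 / (2 * μ)) * Real.sin (1 / μ) - Real.cos (1 / μ) = 0 ↔
      Real.sin (1 / (2 * μ)) + (1 / (2 * μ)) * Real.cos (1 / (2 * μ)) = 0 ∨
        Real.sin (1 / (2 * μ)) = 0 := by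
  rw [one_add_mul_sin_sub_cos_factor, mul_eq_zero, mul_eq_zero]
  simp only [OfNat.ofNat_ne_zero, false_or, or_comm]

/-- Let `E` be the set of positive solutions of `1 + (1/(2μ))·sin(1/μ) − cos(1/μ) = 0`
and `S₂` the set of positive solutions of `sin(1/(2μ)) + (1/(2μ))·cos(1/(2μ)) = 0`.
Then `E = S₂ ∪ {μ > 0 : sin(1/(2μ)) = 0}`, every positive `μ` with `sin(1/(2μ)) = 0`
satisfies `μ ≤ 1/(2π)`, and if `S₂` has a greatest element `μ* > 1/(2π)` then `E`
has a greatest element equal to `μ*`. -/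
theorem stmt_3 :
    ({μ : ℝ | 0 < μ ∧ 1 + (1 / (2 * μ)) * Real.sin (1 / μ) - Real.cos (1 / μ) = 0} =
      {μ : ℝ | 0 < μ ∧
        Real.sin (1 / (2 * μ)) + (1 / (2 * μ)) * Real.cos (1 / (2 * μ)) = 0} ∪
      {μ : ℝ | 0 < μ ∧ Real.sin (1 / (2 * μ)) = 0}) ∧
    (∀ μ : ℝ, 0 < μ → Real.sin (1 / (2 * μ)) = 0 → μ ≤ 1 / (2 * Real.pi)) ∧
    (∀ μs : ℝ,
      IsGreatest {μ : ℝ | 0 < μ ∧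
        Real.sin (1 / (2 * μ)) + (1 / (2 * μ)) * Real.cos (1 / (2 * μ)) = 0} μs →
      1 / (2 * Real.pi) < μs →
      IsGreatest {μ : ℝ | 0 < μ ∧
        1 + (1 / (2 * μ)) * Real.sin (1 / μ) - Real.cos (1 / μ) = 0} μs) := by
  refine ⟨?_, fun μ => le_one_div_two_pi_of_sin_eq_zero, fun μs hs hlt => ⟨?_, ?_⟩⟩
  · ext μ
    simp only [Set.mem_ofPred_eq, Set.mem_union, one_add_mul_sin_sub_cos_eq_zero_iff, and_or_left]
  · exact ⟨hs.1.1, (one_add_mul_sin_sub_cos_eq_zero_iff μs).2 (Or.inl hs.1.2)⟩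
  · rintro μ ⟨hμ, h⟩
    rcases (one_add_mul_sin_sub_cos_eq_zero_iff μ).1 h with h | h
    · exact hs.2 ⟨hμ, h⟩
    · exact (le_one_div_two_pi_of_sin_eq_zero hμ h).trans hlt.le
end

section
/- Let T be the closed triangle in ℝ² with vertices (0,0), (1,0), (0,1). For every function v : ℝ² → ℝ that is continuously differentiable on a neighborhood of T and satisfies the two edge conditions ∫₀¹ v(t,0) dt = 0 and ∫₀¹ v(0,t) dt = 0, one has ∫_T v² dx ≤ (0.24647)² · ∫_T ((∂v/∂x₁)² + (∂v/∂x₂)²) dx. -/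
open MeasureTheory
open Set Real intervalIntegral

theorem nonneg_of_deriv_nonneg_of_zero {f f' : ℝ → ℝ} (hf : ∀ x, HasDerivAt f (f' x) x)
    (h0 : f 0 = 0) (hf' : ∀ x, 0 ≤ x → 0 ≤ f' x) {x : ℝ} (hx : 0 ≤ x) : 0 ≤ f x := by
  have hmono : MonotoneOn f (Ici 0) := by
    refine monotoneOn_of_deriv_nonneg (convex_Ici 0)
      (fun x _ => (hf x).continuousAt.continuousWithinAt)
      (fun x _ => (hf x).differentiableAt.differentiableWithinAt) fun x hx => ?_
    rw [interior_Ici] at hx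
    rw [(hf x).deriv]
    exact hf' x (le_of_lt hx)
  simpa [h0] using hmono (mem_Ici.2 le_rfl) (mem_Ici.2 hx) hx

theorem sin_ge_cubic {x : ℝ} (hx : 0 ≤ x) : x - x ^ 3 / 6 ≤ sin x := by
  have h := nonneg_of_deriv_nonneg_of_zero (f := fun x => sin x - (x - x ^ 3 / 6))
    (f' := fun x => cos x - (1 - x ^ 2 / 2))
    (fun x => ((hasDerivAt_sin x).sub
      ((hasDerivAt_id x).sub ((hasDerivAt_pow 3 x).div_const 6))).congr_deriv
      (by norm_num; ring)) (by simp)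
    (fun x _ => by linarith [one_sub_sq_div_two_le_cos (x := x)]) hx
  linarith

theorem cos_le_quartic {x : ℝ} (hx : 0 ≤ x) : cos x ≤ 1 - x ^ 2 / 2 + x ^ 4 / 24 := by
  have h := nonneg_of_deriv_nonneg_of_zero (f := fun x => 1 - x ^ 2 / 2 + x ^ 4 / 24 - cos x)
    (f' := fun x => sin x - (x - x ^ 3 / 6))
    (fun x => (((((hasDerivAt_pow 2 x).div_const 2).const_sub 1).add
        ((hasDerivAt_pow 4 x).div_const 24)).sub (hasDerivAt_cos x)).congr_deriv
      (by norm_num; ring)) (by simp)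
    (fun x hx => by linarith [sin_ge_cubic hx]) hx
  linarith

theorem sin_le_quintic {x : ℝ} (hx : 0 ≤ x) : sin x ≤ x - x ^ 3 / 6 + x ^ 5 / 120 := by
  have h := nonneg_of_deriv_nonneg_of_zero (f := fun x => x - x ^ 3 / 6 + x ^ 5 / 120 - sin x)
    (f' := fun x => 1 - x ^ 2 / 2 + x ^ 4 / 24 - cos x)
    (fun x => ((((hasDerivAt_id x).sub ((hasDerivAt_pow 3 x).div_const 6)).add
        ((hasDerivAt_pow 5 x).div_const 120)).sub (hasDerivAt_sin x)).congr_deriv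
      (by norm_num; ring)) (by simp)
    (fun x hx => by linarith [cos_le_quartic hx]) hx
  linarith

theorem cos_ge_sextic {x : ℝ} (hx : 0 ≤ x) :
    1 - x ^ 2 / 2 + x ^ 4 / 24 - x ^ 6 / 720 ≤ cos x := by
  have h := nonneg_of_deriv_nonneg_of_zero
    (f := fun x => cos x - (1 - x ^ 2 / 2 + x ^ 4 / 24 - x ^ 6 / 720))
    (f' := fun x => x - x ^ 3 / 6 + x ^ 5 / 120 - sin x)
    (fun x => ((hasDerivAt_cos x).sub (((((hasDerivAt_pow 2 x).div_const 2).const_sub 1).add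
        ((hasDerivAt_pow 4 x).div_const 24)).sub ((hasDerivAt_pow 6 x).div_const 720))).congr_deriv
      (by norm_num; ring)) (by simp)
    (fun x hx => by linarith [sin_le_quintic hx]) hx
  linarith

theorem sin_add_mul_cos_nonneg :
    0 ≤ sin (1 / (2 * 0.24647)) + 1 / (2 * 0.24647) * cos (1 / (2 * 0.24647)) := by
  set θ : ℝ := 1 / (2 * 0.24647) with hθ
  have hπ1 := pi_gt_d6
  have hπ2 := pi_lt_d6
  set δ : ℝ := θ - π / 2 with hδ
  have e : θ = δ + π / 2 := by ring
  have hs : sin θ = cos δ := by rw [e, sin_add_pi_div_two]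
  have hc : cos θ = -sin δ := by rw [e, cos_add_pi_div_two]
  have hδ1 : 0.45784 ≤ δ := by rw [hδ, hθ]; norm_num at *; linarith
  have hδ2 : δ ≤ 0.45785 := by rw [hδ, hθ]; norm_num at *; linarith
  have hδ0 : 0 ≤ δ := by linarith
  have h1 := cos_ge_sextic (x := 0.45785) (by norm_num)
  have h2 := sin_le_quintic (x := 0.45785) (by norm_num)
  have h3 : cos 0.45785 ≤ cos δ := cos_le_cos_of_nonneg_of_le_pi hδ0 (by linarith) hδ2
  have h4 : sin δ ≤ sin 0.45785 :=
    sin_le_sin_of_le_of_le_pi_div_two (by linarith) (by linarith) hδ2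
  have h5 : θ * sin δ ≤ θ * sin 0.45785 := by gcongr
  have h6 : θ * sin 0.45785 ≤ cos 0.45785 := by
    rw [hθ]; norm_num at *; linarith
  rw [hs, hc, mul_neg, ← sub_eq_add_neg]
  exact sub_nonneg.2 (h5.trans (h6.trans h3))

/-- Jacobi's form of Wirtinger's inequality on an interval, with boundary terms. -/
theorem wirtinger_with_boundary {a b s ω : ℝ} (hab : a ≤ b)
    (ha : -(π / 2) < ω * (a - s)) (hb : ω * (b - s) < π / 2) (hω : 0 < ω)
    {u u' : ℝ → ℝ} {S : Set ℝ} (hS : S.Countable) (hu : Continuous u)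
    (hd : ∀ x ∈ Ioo a b \ S, HasDerivAt u (u' x) x)
    (hi : IntervalIntegrable u' volume a b)
    (hi2 : IntervalIntegrable (fun x => u' x ^ 2) volume a b) :
    ω ^ 2 * (∫ x in a..b, u x ^ 2) - ω * tan (ω * (b - s)) * u b ^ 2
      + ω * tan (ω * (a - s)) * u a ^ 2 ≤ ∫ x in a..b, u' x ^ 2 := by
  have hcos : ∀ x ∈ Icc a b, cos (ω * (x - s)) ≠ 0 := by
    intro x hx
    refine (cos_pos_of_mem_Ioo ⟨ha.trans_le ?_, lt_of_le_of_lt ?_ hb⟩).ne'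
    · gcongr; exact hx.1
    · gcongr; exact hx.2
  set φ : ℝ → ℝ := fun x => -(ω * tan (ω * (x - s))) with hφ
  set φ' : ℝ → ℝ := fun x => -(ω ^ 2 * (1 + tan (ω * (x - s)) ^ 2)) with hφ'
  have hφd : ∀ x ∈ Icc a b, HasDerivAt φ (φ' x) x := by
    intro x hx
    have h1 : HasDerivAt (fun x => ω * (x - s)) (ω * 1) x :=
      ((hasDerivAt_id x).sub_const s).const_mul ω
    have h2 := ((((hasDerivAt_tan (hcos x hx)).comp x h1).const_mul ω)).neg
    refine h2.congr_deriv ?_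
    simp only [hφ']
    rw [one_div, ← inv_one_add_tan_sq (hcos x hx), inv_inv]
    ring
  have hφc : ContinuousOn φ (Icc a b) := fun x hx =>
    (hφd x hx).continuousAt.continuousWithinAt
  have htanc : ContinuousOn φ' (Icc a b) := by
    have : φ' = fun x => -(ω ^ 2 + φ x ^ 2) := by
      funext x; simp only [hφ', hφ]; ring
    rw [this]
    fun_prop
  have hφi : ContinuousOn φ (uIcc a b) := by rwa [uIcc_of_le hab]
  have hφi' : ContinuousOn φ' (uIcc a b) := by rwa [uIcc_of_le hab]
  set W' : ℝ → ℝ := fun x => φ' x * u x ^ 2 + (2 * φ x * u x) * u' x with hW'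
  have hWi : IntervalIntegrable W' volume a b := by
    refine IntervalIntegrable.add ?_ ?_
    · exact (hφi'.mul (by fun_prop)).intervalIntegrable
    · exact hi.continuousOn_mul (by fun_prop)
  have hftc := integral_eq_of_hasDerivAt_off_countable_of_le (fun x => φ x * u x ^ 2) W' hab hS
    (by fun_prop) (fun x hx => by
      have h1 := (hφd x (Ioo_subset_Icc_self hx.1)).mul ((hd x hx).pow 2)
      refine h1.congr_deriv ?_
      simp only [hW', Pi.pow_apply]; norm_num; ring) hWi
  have hui : IntervalIntegrable (fun x => ω ^ 2 * u x ^ 2) volume a b :=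
    Continuous.intervalIntegrable (by fun_prop) _ _
  have hle : ∫ x in a..b, W' x ≤ ∫ x in a..b, (u' x ^ 2 - ω ^ 2 * u x ^ 2) := by
    refine integral_mono_on hab hWi (hi2.sub hui) fun x _ => ?_
    simp only [hW', hφ', hφ]
    nlinarith [sq_nonneg (u' x + ω * tan (ω * (x - s)) * u x)]
  rw [hftc, intervalIntegral.integral_sub hi2 hui, intervalIntegral.integral_const_mul] at hle
  simp only [hφ] at hle
  linarith

/-- A Wirtinger inequality on the unit interval for the deviation from the midpoint value. -/
theorem wirtinger_midpoint {s ω : ℝ} (hω : 0 < ω) (hs0 : ω * s < π / 2)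
    (hs1 : ω * (1 / 2 - s) < π / 2)
    {u u' : ℝ → ℝ} {S : Set ℝ} (hS : S.Countable) (hu : Continuous u)
    (hd : ∀ x ∈ Ioo 0 1 \ S, HasDerivAt u (u' x) x)
    (hi : IntervalIntegrable u' volume 0 1)
    (hi2 : IntervalIntegrable (fun x => u' x ^ 2) volume 0 1)
    (hmean : ∫ x in (0 : ℝ)..1, u x = 0) :
    ω ^ 2 * ((∫ x in (0 : ℝ)..1, u x ^ 2) + u (1 / 2) ^ 2)
      ≤ (∫ x in (0 : ℝ)..1, u' x ^ 2)
        + ω * tan (ω * s) * ((u 0 - u (1 / 2)) ^ 2 + (u 1 - u (1 / 2)) ^ 2) := by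
  set c := u (1 / 2) with hc
  have hsub1 : uIcc (0 : ℝ) (1 / 2) ⊆ uIcc 0 1 := by
    rw [uIcc_of_le (by norm_num), uIcc_of_le (by norm_num)]
    exact Icc_subset_Icc_right (by norm_num)
  have hsub2 : uIcc (1 / 2 : ℝ) 1 ⊆ uIcc 0 1 := by
    rw [uIcc_of_le (by norm_num), uIcc_of_le (by norm_num)]
    exact Icc_subset_Icc_left (by norm_num)
  have h1 := wirtinger_with_boundary (a := 0) (b := 1 / 2) (s := s) (ω := ω) (by norm_num)
    (by linarith) hs1 hω hS (u := fun x => u x - c) (u' := u') (by fun_prop)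
    (fun x hx => (hd x ⟨⟨hx.1.1, by linarith [hx.1.2]⟩, hx.2⟩).sub_const c)
    (hi.mono_set hsub1) (hi2.mono_set hsub1)
  have h2 := wirtinger_with_boundary (a := 1 / 2) (b := 1) (s := 1 - s) (ω := ω) (by norm_num)
    (by linarith) (by linarith) hω hS (u := fun x => u x - c) (u' := u') (by fun_prop)
    (fun x hx => (hd x ⟨⟨by linarith [hx.1.1], hx.1.2⟩, hx.2⟩).sub_const c)
    (hi.mono_set hsub2) (hi2.mono_set hsub2)
  have e1 := integral_add_adjacent_intervals (hi2.mono_set hsub1) (hi2.mono_set hsub2)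
  have hcont : Continuous fun x => (u x - c) ^ 2 := by fun_prop
  have e2 := integral_add_adjacent_intervals (hcont.intervalIntegrable (μ := volume) 0 (1 / 2))
    (hcont.intervalIntegrable (1 / 2) 1)
  have e3 : ∫ x in (0 : ℝ)..1, (u x - c) ^ 2 = (∫ x in (0 : ℝ)..1, u x ^ 2) + c ^ 2 := by
    have : ∀ x, (u x - c) ^ 2 = u x ^ 2 - 2 * c * u x + c ^ 2 := fun x => by ring
    simp only [this]
    rw [intervalIntegral.integral_add, intervalIntegral.integral_sub,
      intervalIntegral.integral_const_mul, hmean]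
    · simp
    all_goals exact Continuous.intervalIntegrable (by fun_prop) _ _
  have t1 : tan (ω * (0 - s)) = -tan (ω * s) := by rw [← tan_neg]; ring_nf
  have t2 : ω * (1 - (1 - s)) = ω * s := by ring
  simp only [t1, t2, ← hc, sub_self] at h1 h2
  nlinarith

/-- The Poincaré inequality for mean-zero functions on the unit interval, with constant `9 < π²`. -/
theorem poincare_mean_zero {u u' : ℝ → ℝ} {S : Set ℝ} (hS : S.Countable) (hu : Continuous u)
    (hd : ∀ x ∈ Ioo 0 1 \ S, HasDerivAt u (u' x) x)
    (hi : IntervalIntegrable u' volume 0 1)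
    (hi2 : IntervalIntegrable (fun x => u' x ^ 2) volume 0 1)
    (hmean : ∫ x in (0 : ℝ)..1, u x = 0) :
    9 * (∫ x in (0 : ℝ)..1, u x ^ 2) ≤ ∫ x in (0 : ℝ)..1, u' x ^ 2 := by
  have hπ := pi_gt_d6
  have h := wirtinger_midpoint (s := 0) (ω := 3) (by norm_num) (by linarith)
    (by norm_num at *; linarith) hS hu hd hi hi2 hmean
  simp only [mul_zero, tan_zero, zero_mul, add_zero] at h
  nlinarith [sq_nonneg (u (1 / 2))]

/-- For mean-zero functions vanishing at both end points the constant is at least `0.24647⁻²`. -/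
theorem poincare_mean_zero_dirichlet {u u' : ℝ → ℝ} (hu : Continuous u)
    (hd : ∀ x, HasDerivAt u (u' x) x)
    (hi : IntervalIntegrable u' volume 0 1)
    (hi2 : IntervalIntegrable (fun x => u' x ^ 2) volume 0 1)
    (hmean : ∫ x in (0 : ℝ)..1, u x = 0)
    (h0 : u 0 = 0) (h1 : u 1 = 0) :
    (1 / 0.24647) ^ 2 * (∫ x in (0 : ℝ)..1, u x ^ 2) ≤ ∫ x in (0 : ℝ)..1, u' x ^ 2 := by
  have hπ := pi_gt_d6
  set ω : ℝ := 1 / 0.24647 with hω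
  have hω4 : 4 < ω := by rw [hω]; norm_num
  have h := wirtinger_midpoint (s := 0.12) (ω := ω) (by linarith)
    (by rw [hω]; norm_num at *; linarith)
    (by rw [hω]; norm_num at *; linarith) (S := ∅) countable_empty hu (fun x _ => hd x) hi hi2 hmean
  have ht : tan (ω * 0.12) ≤ 1 := by
    rw [← tan_pi_div_four]
    refine (tan_lt_tan_of_lt_of_lt_pi_div_two ?_ (by linarith) ?_).le <;>
    · rw [hω]; norm_num at *; linarith
  rw [h0, h1] at h
  have : ω * tan (ω * 0.12) * u (1 / 2) ^ 2 ≤ ω * 1 * u (1 / 2) ^ 2 := by gcongr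
  have h2 : 0 ≤ (ω - 4) * ω * u (1 / 2) ^ 2 :=
    mul_nonneg (mul_nonneg (by linarith) (by linarith)) (sq_nonneg _)
  have h3 : 0 ≤ ω * u (1 / 2) ^ 2 := mul_nonneg (by linarith) (sq_nonneg _)
  clear_value ω
  nlinarith

/-- The one-dimensional inequality for functions vanishing at both end points of the unit interval,
with the nonlocal mean term. It is extremal, up to rounding of the constant, for
`cos (ω (x - 1/2)) - cos (ω / 2)`. -/
theorem poincare_dirichlet_with_mean {g g' : ℝ → ℝ} (hg : Continuous g)
    (hd : ∀ x, HasDerivAt g (g' x) x)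
    (hi : IntervalIntegrable g' volume 0 1)
    (hi2 : IntervalIntegrable (fun x => g' x ^ 2) volume 0 1)
    (h0 : g 0 = 0) (h1 : g 1 = 0) :
    (1 / 0.24647) ^ 2 * ((∫ x in (0 : ℝ)..1, g x ^ 2) - (∫ x in (0 : ℝ)..1, g x) ^ 2 / 2)
      ≤ ∫ x in (0 : ℝ)..1, g' x ^ 2 := by
  have hθcs := sin_add_mul_cos_nonneg
  have hθ2 : (2 : ℝ) < 1 / (2 * 0.24647) := by norm_num
  have hθ3 : (1 / (2 * 0.24647) : ℝ) < 3 := by norm_num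
  have hω : (1 / 0.24647 : ℝ) = 2 * (1 / (2 * 0.24647)) := by norm_num
  have hdir := @poincare_mean_zero_dirichlet
  rw [hω] at hdir ⊢
  generalize (1 / (2 * 0.24647) : ℝ) = θ at *
  have hπ := pi_gt_d6
  have hsin : 0 < sin θ := sin_pos_of_pos_of_lt_pi (by linarith) (by linarith)
  have hcos : cos θ < 0 := cos_neg_of_pi_div_two_lt_of_lt (by linarith [pi_lt_d6]) (by linarith)
  set p : ℝ → ℝ := fun x => cos (2 * θ * (x - 1 / 2)) - cos θ with hp
  set p' : ℝ → ℝ := fun x => -(2 * θ * sin (2 * θ * (x - 1 / 2))) with hp'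
  have hlin : ∀ x : ℝ, HasDerivAt (fun x => 2 * θ * (x - 1 / 2)) (2 * θ * 1) x := fun x =>
    ((hasDerivAt_id x).sub_const _).const_mul _
  have hpd : ∀ x, HasDerivAt p (p' x) x := fun x =>
    ((hlin x).cos.sub_const (cos θ)).congr_deriv (by simp only [hp']; ring)
  have hpd' : ∀ x, HasDerivAt p' (-((2 * θ) ^ 2 * (p x + cos θ))) x := fun x =>
    ((hlin x).sin.const_mul (2 * θ)).neg.congr_deriv (by simp only [hp]; ring)
  have hpc : Continuous p := by fun_prop
  have hpc' : Continuous p' := by fun_prop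
  have hp0 : p 0 = 0 := by
    simp only [hp]; rw [show 2 * θ * (0 - 1 / 2) = -θ by ring, cos_neg, sub_self]
  have hp1 : p 1 = 0 := by
    simp only [hp]; rw [show 2 * θ * (1 - 1 / 2) = θ by ring, sub_self]
  have hn : θ * ∫ x in (0 : ℝ)..1, p x = sin θ - θ * cos θ := by
    have := integral_eq_sub_of_hasDerivAt (a := 0) (b := 1) (f := fun x =>
      sin (2 * θ * (x - 1 / 2)) / 2 - θ * cos θ * x) (f' := fun x => θ * p x) (fun x _ =>
      (((hlin x).sin.div_const 2).sub ((hasDerivAt_id x).const_mul (θ * cos θ))).congr_deriv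
        (by simp only [hp]; ring)) (Continuous.intervalIntegrable (by fun_prop) _ _)
    rw [intervalIntegral.integral_const_mul] at this
    rw [this, show 2 * θ * (0 - 1 / 2) = -θ by ring, show 2 * θ * (1 - 1 / 2) = θ by ring, sin_neg]
    ring
  set n := ∫ x in (0 : ℝ)..1, p x with hn_def
  have hnpos : 0 < n := by
    have : 0 < θ * n := by rw [hn]; nlinarith
    exact pos_of_mul_pos_right this (by linarith)
  set m := ∫ x in (0 : ℝ)..1, g x with hm
  set α := m / n with hα
  have hαn : α * n = m := by rw [hα]; field_simp
  have ii : ∀ f : ℝ → ℝ, Continuous f → IntervalIntegrable f volume 0 1 := fun f hf =>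
    hf.intervalIntegrable _ _
  have hgp' : IntervalIntegrable (fun x => g' x * p' x) volume 0 1 :=
    hi.mul_continuousOn hpc'.continuousOn
  have hmean : ∫ x in (0 : ℝ)..1, (g x - α * p x) = 0 := by
    rw [intervalIntegral.integral_sub (ii _ hg) (ii _ (by fun_prop)),
      intervalIntegral.integral_const_mul, ← hn_def, hαn, sub_self]
  have hsq : IntervalIntegrable (fun x => (g' x - α * p' x) ^ 2) volume 0 1 := by
    have e : (fun x => (g' x - α * p' x) ^ 2)
        = fun x => g' x ^ 2 - 2 * α * (g' x * p' x) + α ^ 2 * p' x ^ 2 := by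
      funext x; ring
    rw [e]
    exact (hi2.sub (hgp'.const_mul _)).add (ii _ (by fun_prop))
  have hh := @hdir (fun x => g x - α * p x) (fun x => g' x - α * p' x) (by fun_prop)
    (fun x => (hd x).sub ((hpd x).const_mul α)) (hi.sub (ii _ (by fun_prop))) hsq hmean
    (by simp [h0, hp0]) (by simp [h1, hp1])
  set W' : ℝ → ℝ := fun x => α * (2 * (g' x * p' x) - α * p' x ^ 2)
      - (2 * θ) ^ 2 * (α * (2 * g x - α * p x) * (p x + cos θ)) with hW'
  have hWi1 : IntervalIntegrable (fun x => α * (2 * (g' x * p' x) - α * p' x ^ 2)) volume 0 1 :=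
    ((hgp'.const_mul 2).sub (ii _ (by fun_prop))).const_mul α
  have hWi2 : IntervalIntegrable (fun x => (2 * θ) ^ 2 * (α * (2 * g x - α * p x) * (p x + cos θ)))
      volume 0 1 := ii _ (by fun_prop)
  have hW : ∫ x in (0 : ℝ)..1, W' x = 0 := by
    rw [integral_eq_sub_of_hasDerivAt (f := fun x => α * ((2 * g x - α * p x) * p' x))
      (fun x _ => (((((hd x).const_mul 2).sub ((hpd x).const_mul α)).mul (hpd' x)).const_mul
        α).congr_deriv (by simp only [Pi.sub_apply]; ring)) (hWi1.sub hWi2)]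
    simp [h0, h1, hp0, hp1]
  have hE : ∫ x in (0 : ℝ)..1, (g' x - α * p' x) ^ 2 = (∫ x in (0 : ℝ)..1, g' x ^ 2)
      - ∫ x in (0 : ℝ)..1, α * (2 * (g' x * p' x) - α * p' x ^ 2) := by
    rw [← intervalIntegral.integral_sub hi2 hWi1]
    congr 1; funext x; ring
  have hF : (∫ x in (0 : ℝ)..1, α * (2 * g x - α * p x) * (p x + cos θ))
      = (∫ x in (0 : ℝ)..1, g x ^ 2) - (∫ x in (0 : ℝ)..1, (g x - α * p x) ^ 2)
        + α * cos θ * (2 * m - α * n) := by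
    rw [hm, hn_def, ← intervalIntegral.integral_const_mul, ← intervalIntegral.integral_const_mul,
      ← intervalIntegral.integral_sub, ← intervalIntegral.integral_sub,
      ← intervalIntegral.integral_const_mul, ← intervalIntegral.integral_add]
    · congr 1; funext x; ring
    all_goals exact ii _ (by fun_prop)
  simp only [hW'] at hW
  rw [intervalIntegral.integral_sub hWi1 hWi2, intervalIntegral.integral_const_mul
    ((2 * θ) ^ 2), hF] at hW
  have key : 0 ≤ α * cos θ * (2 * m - α * n) + m ^ 2 / 2 := by
    have e : θ * (α * cos θ * (2 * m - α * n) + m ^ 2 / 2)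
        = α ^ 2 * n / 2 * (sin θ + θ * cos θ) := by
      rw [← hαn]
      linear_combination (α ^ 2 * n / 2) * hn
    have : 0 ≤ θ * (α * cos θ * (2 * m - α * n) + m ^ 2 / 2) := by
      rw [e]; exact mul_nonneg (by positivity) hθcs
    exact nonneg_of_mul_nonneg_right this (by linarith)
  have key2 := mul_nonneg (sq_nonneg (2 * θ)) key
  rw [hE] at hh
  clear_value W' α m n p p'
  linarith

/-- Bounded measurable real functions: these are integrable for every finite measure. -/
structure BoundedMeasurable {α : Type*} [MeasurableSpace α] (f : α → ℝ) : Prop where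
  measurable : Measurable f
  bounded : ∃ C, ∀ x, |f x| ≤ C

namespace BoundedMeasurable

variable {α β : Type*} [MeasurableSpace α] [MeasurableSpace β] {f g : α → ℝ}

theorem add (hf : BoundedMeasurable f) (hg : BoundedMeasurable g) :
    BoundedMeasurable fun x => f x + g x := by
  obtain ⟨C, hC⟩ := hf.bounded
  obtain ⟨C', hC'⟩ := hg.bounded
  exact ⟨hf.measurable.add hg.measurable, C + C', fun x =>
    (abs_add_le _ _).trans (add_le_add (hC x) (hC' x))⟩

theorem mul (hf : BoundedMeasurable f) (hg : BoundedMeasurable g) :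
    BoundedMeasurable fun x => f x * g x := by
  obtain ⟨C, hC⟩ := hf.bounded
  obtain ⟨C', hC'⟩ := hg.bounded
  refine ⟨hf.measurable.mul hg.measurable, C * C', fun x => ?_⟩
  rw [abs_mul]
  exact mul_le_mul (hC x) (hC' x) (abs_nonneg _) ((abs_nonneg _).trans (hC x))

theorem const (c : ℝ) : BoundedMeasurable fun _ : α => c :=
  ⟨measurable_const, |c|, fun _ => le_rfl⟩

theorem sub (hf : BoundedMeasurable f) (hg : BoundedMeasurable g) :
    BoundedMeasurable fun x => f x - g x := by
  convert hf.add ((const (-1)).mul hg) using 2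
  ring

theorem sq (hf : BoundedMeasurable f) : BoundedMeasurable fun x => f x ^ 2 := by
  simpa only [pow_two] using hf.mul hf

theorem comp (hf : BoundedMeasurable f) {φ : β → α} (hφ : Measurable φ) :
    BoundedMeasurable fun x => f (φ x) :=
  ⟨hf.measurable.comp hφ, hf.bounded.imp fun _ h x => h (φ x)⟩

theorem integrable (hf : BoundedMeasurable f) (μ : Measure α) [IsFiniteMeasure μ] :
    Integrable f μ := by
  obtain ⟨C, hC⟩ := hf.bounded
  exact Integrable.of_bound hf.measurable.aestronglyMeasurable C (ae_of_all _ hC)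

theorem intervalIntegrable {f : ℝ → ℝ} (hf : BoundedMeasurable f) (a b : ℝ) :
    IntervalIntegrable f volume a b :=
  ⟨hf.integrable _, hf.integrable _⟩

theorem integral_right {f : α × β → ℝ} (hf : BoundedMeasurable f) (μ : Measure β)
    [IsFiniteMeasure μ] : BoundedMeasurable fun x => ∫ y, f (x, y) ∂μ := by
  obtain ⟨C, hC⟩ := hf.bounded
  exact ⟨hf.measurable.stronglyMeasurable.integral_prod_right'.measurable, C * μ.real univ,
    fun x => norm_integral_le_of_norm_le_const (f := fun y => f (x, y))
      (ae_of_all _ fun y => hC (x, y))⟩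

end BoundedMeasurable

/-- Lebesgue measure on the unit interval. -/
noncomputable def unitMeasure : Measure ℝ := volume.restrict (Icc 0 1)

instance : IsProbabilityMeasure unitMeasure := ⟨by simp [unitMeasure]⟩

theorem integral_unitMeasure (f : ℝ → ℝ) : ∫ x, f x ∂unitMeasure = ∫ x in (0 : ℝ)..1, f x := by
  rw [unitMeasure, integral_Icc_eq_integral_Ioc, integral_of_le zero_le_one]

/-- The inequality on the unit square for functions symmetric about the diagonal `x + y = 1` and
possibly not differentiable across it. -/
theorem poincare_unit_square {V D : ℝ × ℝ → ℝ} {K : NNReal} (hV : Continuous V)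
    (hVb : BoundedMeasurable V) (hD : BoundedMeasurable D)
    (hsymm : ∀ x y, V (1 - y, 1 - x) = V (x, y))
    (hlip : ∀ y, LipschitzWith K fun x => V (x, y))
    (hder : ∀ x y, x ≠ 1 - y → HasDerivAt (fun x => V (x, y)) (D (x, y)) x)
    (h0 : ∫ y in (0 : ℝ)..1, V (0, y) = 0) (h1 : ∫ y in (0 : ℝ)..1, V (1, y) = 0) :
    (1 / 0.24647) ^ 2 / 2 * ∫ p, V p ^ 2 ∂(unitMeasure.prod unitMeasure)
      ≤ ∫ p, D p ^ 2 ∂(unitMeasure.prod unitMeasure) := by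
  set μ := unitMeasure with hμ
  set A : ℝ → ℝ := fun x => ∫ y, V (x, y) ∂μ with hA
  set A' : ℝ → ℝ := fun x => ∫ y, D (x, y) ∂μ with hA'
  have hAb : BoundedMeasurable A := hVb.integral_right μ
  have hAb' : BoundedMeasurable A' := hD.integral_right μ
  have hAd : ∀ x, HasDerivAt A (A' x) x := by
    intro x
    refine (hasDerivAt_integral_of_dominated_loc_of_lip (F := fun x y => V (x, y))
      (F' := fun y => D (x, y)) (bound := fun _ => (K : ℝ)) Filter.univ_mem
      (.of_forall fun z => (hVb.comp (by fun_prop)).measurable.aestronglyMeasurable)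
      ((hVb.comp (by fun_prop)).integrable _)
      (hD.comp (by fun_prop)).measurable.aestronglyMeasurable
      (ae_of_all _ fun y => ?_) (integrable_const _) ?_).2
    · simpa using hlip y
    · have : ∀ᵐ y ∂μ, y ≠ 1 - x := by
        refine ae_restrict_of_ae ?_
        simp [ae_iff]
      filter_upwards [this] with y hy
      exact hder x y fun h => hy (by rw [h]; ring)
  have hAc : Continuous A := continuous_iff_continuousAt.2 fun x => (hAd x).continuousAt
  set m := ∫ x, A x ∂μ with hm
  have hrow : ∀ y, ∫ x, V (x, y) ∂μ = A (1 - y) := by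
    intro y
    simp only [hA, hμ, integral_unitMeasure]
    have := integral_comp_sub_left (a := 0) (b := 1) (fun z => V (1 - y, z)) 1
    simp only [hsymm] at this
    simpa using this
  have hB : ∀ F : ℝ → ℝ, ∫ y, F (1 - y) ∂μ = ∫ y, F y ∂μ := by
    intro F
    simp only [hμ, integral_unitMeasure]
    simp
  have hBb : BoundedMeasurable fun y => A (1 - y) := hAb.comp (by fun_prop)
  have hA1 : BoundedMeasurable fun p : ℝ × ℝ => A p.1 := hAb.comp measurable_fst
  have hA1' : BoundedMeasurable fun p : ℝ × ℝ => A' p.1 := hAb'.comp measurable_fst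
  have hB2 : BoundedMeasurable fun p : ℝ × ℝ => A (1 - p.2) := hBb.comp measurable_snd
  set f : ℝ × ℝ → ℝ := fun p => V p - A p.1 - A (1 - p.2) + m with hf
  set E : ℝ × ℝ → ℝ := fun p => D p - A' p.1 with hE
  have hfb : BoundedMeasurable f := ((hVb.sub hA1).sub hB2).add (.const m)
  have hEb : BoundedMeasurable E := hD.sub hA1'
  have hpoin : 9 * ∫ p, f p ^ 2 ∂(μ.prod μ) ≤ ∫ p, E p ^ 2 ∂(μ.prod μ) := by
    rw [integral_prod_symm _ (hfb.sq.integrable _), integral_prod_symm _ (hEb.sq.integrable _),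
      ← MeasureTheory.integral_const_mul]
    refine integral_mono (((hfb.sq.integrable _).integral_prod_right).const_mul 9)
      (hEb.sq.integrable _).integral_prod_right fun y => ?_
    simp only [hμ, integral_unitMeasure]
    refine poincare_mean_zero (S := {1 - y}) (countable_singleton _)
      (u := fun x => f (x, y)) (u' := fun x => E (x, y)) (by fun_prop) (fun x hx => ?_)
      ((hEb.comp (by fun_prop)).intervalIntegrable _ _)
      ((hEb.sq.comp (by fun_prop)).intervalIntegrable _ _) ?_
    · exact (((hder x y hx.2).sub (hAd x)).sub_const (A (1 - y))).add_const m
    · rw [← integral_unitMeasure]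
      simp only [hf]
      rw [MeasureTheory.integral_add ?_ (integrable_const _),
        MeasureTheory.integral_sub ?_ (integrable_const _),
        MeasureTheory.integral_sub ((hVb.comp (by fun_prop)).integrable _) (hAb.integrable _),
        ← hμ, hrow]
      · simp [hm]
      · exact ((hVb.comp (by fun_prop)).sub hAb).integrable _
      · exact (((hVb.comp (by fun_prop)).sub hAb).sub (.const _)).integrable _
  set a := ∫ x, A x ^ 2 ∂μ with ha
  have hVA : ∫ p, V p * A p.1 ∂(μ.prod μ) = a := by
    rw [integral_prod _ ((hVb.mul hA1).integrable _)]
    simp only [MeasureTheory.integral_mul_const, ha]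
    congr 1; funext x; rw [pow_two]
  have hVB : ∫ p, V p * A (1 - p.2) ∂(μ.prod μ) = a := by
    rw [integral_prod_symm _ ((hVb.mul hB2).integrable _)]
    simp only [MeasureTheory.integral_mul_const, hrow, ha]
    rw [← hB fun y => A y ^ 2]
    congr 1; funext x; rw [pow_two]
  have hVm : ∫ p, V p ∂(μ.prod μ) = m := integral_prod _ (hVb.integrable _)
  have hAA : ∫ p : ℝ × ℝ, A p.1 ^ 2 ∂(μ.prod μ) = a := by
    rw [integral_prod _ (hA1.sq.integrable _)]; simp [ha]
  have hBB : ∫ p : ℝ × ℝ, A (1 - p.2) ^ 2 ∂(μ.prod μ) = a := by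
    rw [integral_prod_symm _ (hB2.sq.integrable _), ha, ← hB fun y => A y ^ 2]; simp
  have hAm : ∫ p : ℝ × ℝ, A p.1 ∂(μ.prod μ) = m := by
    rw [integral_prod _ (hA1.integrable _)]; simp [hm]
  have hBm : ∫ p : ℝ × ℝ, A (1 - p.2) ∂(μ.prod μ) = m := by
    rw [integral_prod_symm _ (hB2.integrable _), hm, ← hB A]; simp
  have hAB : ∫ p : ℝ × ℝ, A p.1 * A (1 - p.2) ∂(μ.prod μ) = m * m := by
    rw [integral_prod_mul A fun y => A (1 - y), hB A]
  have hfsq : ∫ p, f p ^ 2 ∂(μ.prod μ) = (∫ p, V p ^ 2 ∂(μ.prod μ)) - 2 * a + m ^ 2 := by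
    have e : ∀ p, f p ^ 2 = V p ^ 2 + (A p.1 ^ 2 + (A (1 - p.2) ^ 2 + (m ^ 2 + ((-2) * (V p * A p.1)
        + ((-2) * (V p * A (1 - p.2)) + (2 * m * V p + (2 * (A p.1 * A (1 - p.2))
        + ((-(2 * m)) * A p.1 + (-(2 * m)) * A (1 - p.2))))))))) := fun p => by
      simp only [hf]; ring
    simp only [e]
    have b1 := ((BoundedMeasurable.const (-(2 * m))).mul hA1)
    have b2 := ((BoundedMeasurable.const (-(2 * m))).mul hB2)
    have b3 := ((BoundedMeasurable.const 2).mul (hA1.mul hB2))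
    have b4 := ((BoundedMeasurable.const (2 * m)).mul hVb)
    have b5 := ((BoundedMeasurable.const (-2)).mul (hVb.mul hB2))
    have b6 := ((BoundedMeasurable.const (-2)).mul (hVb.mul hA1))
    have b7 := BoundedMeasurable.const (α := ℝ × ℝ) (m ^ 2)
    have c1 := b1.add b2
    have c2 := b3.add c1
    have c3 := b4.add c2
    have c4 := b5.add c3
    have c5 := b6.add c4
    have c6 := b7.add c5
    have c7 := hB2.sq.add c6
    have c8 := hA1.sq.add c7
    rw [MeasureTheory.integral_add (hVb.sq.integrable _) (c8.integrable _),
      MeasureTheory.integral_add (hA1.sq.integrable _) (c7.integrable _),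
      MeasureTheory.integral_add (hB2.sq.integrable _) (c6.integrable _),
      MeasureTheory.integral_add (b7.integrable _) (c5.integrable _),
      MeasureTheory.integral_add (b6.integrable _) (c4.integrable _),
      MeasureTheory.integral_add (b5.integrable _) (c3.integrable _),
      MeasureTheory.integral_add (b4.integrable _) (c2.integrable _),
      MeasureTheory.integral_add (b3.integrable _) (c1.integrable _),
      MeasureTheory.integral_add (b1.integrable _) (b2.integrable _)]
    simp only [MeasureTheory.integral_const_mul, hVA, hVB, hVm, hAA, hBB, hAm, hBm, hAB]
    simp only [MeasureTheory.integral_const, probReal_univ, smul_eq_mul]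
    ring
  set a' := ∫ x, A' x ^ 2 ∂μ with ha'
  have hEsq : ∫ p, E p ^ 2 ∂(μ.prod μ) = (∫ p, D p ^ 2 ∂(μ.prod μ)) - a' := by
    have e : ∀ p, E p ^ 2 = D p ^ 2 - 2 * (D p * A' p.1) + A' p.1 ^ 2 := fun p => by
      simp only [hE]; ring
    have b1 := ((BoundedMeasurable.const 2).mul (hD.mul hA1'))
    have d1 : ∫ p, D p * A' p.1 ∂(μ.prod μ) = a' := by
      rw [integral_prod _ ((hD.mul hA1').integrable _)]
      simp only [MeasureTheory.integral_mul_const, ha']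
      congr 1; funext x; rw [pow_two]
    have d2 : ∫ p : ℝ × ℝ, A' p.1 ^ 2 ∂(μ.prod μ) = a' := by
      rw [integral_prod _ (hA1'.sq.integrable _)]; simp [ha']
    simp only [e]
    rw [MeasureTheory.integral_add ((hD.sq.sub b1).integrable _) (hA1'.sq.integrable _),
      MeasureTheory.integral_sub (hD.sq.integrable _) (b1.integrable _),
      MeasureTheory.integral_const_mul, d1, d2]
    ring
  have hone := poincare_dirichlet_with_mean hAc hAd (hAb'.intervalIntegrable _ _)
    (hAb'.sq.intervalIntegrable _ _)
    (by simpa only [hA, hμ, integral_unitMeasure] using h0)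
    (by simpa only [hA, hμ, integral_unitMeasure] using h1)
  simp only [← integral_unitMeasure, ← hμ, ← hm, ← ha, ← ha'] at hone
  have hfnn : 0 ≤ ∫ p, f p ^ 2 ∂(μ.prod μ) := integral_nonneg fun p => sq_nonneg _
  rw [hfsq] at hfnn
  rw [hfsq, hEsq] at hpoin
  have hc : ((1 : ℝ) / 0.24647) ^ 2 / 2 ≤ 9 := by norm_num
  have := mul_nonneg (sub_nonneg.2 hc) hfnn
  generalize ((1 : ℝ) / 0.24647) ^ 2 = L at *
  nlinarith

/-- The unit right isosceles triangle, described by inequalities. -/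
def unitTriangle : Set (ℝ × ℝ) := {p | 0 ≤ p.1 ∧ 0 ≤ p.2 ∧ p.1 + p.2 ≤ 1}

theorem convexHull_eq_unitTriangle :
    convexHull ℝ {((0 : ℝ), (0 : ℝ)), (1, 0), (0, 1)} = unitTriangle := by
  refine Subset.antisymm (convexHull_min ?_ ?_) ?_
  · rintro p (rfl | rfl | rfl) <;> norm_num [unitTriangle]
  · rintro p ⟨h1, h2, h3⟩ q ⟨k1, k2, k3⟩ a b ha hb hab
    simp only [unitTriangle, mem_ofPred_eq, Prod.fst_add, Prod.smul_fst, Prod.snd_add,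
      Prod.smul_snd, smul_eq_mul]
    refine ⟨by positivity, by positivity, ?_⟩
    nlinarith
  · rintro ⟨x, y⟩ ⟨h1, h2, h3⟩
    simp only at h1 h2 h3
    rw [convexHull_insert (by simp), convexHull_pair]
    simp only [convexJoin, mem_iUnion, mem_singleton_iff, exists_prop, exists_eq_left]
    rcases (add_nonneg h1 h2).eq_or_lt with h | h
    · refine ⟨(1, 0), left_mem_segment _ _ _, ?_⟩
      have : x = 0 := by linarith
      have : y = 0 := by linarith
      subst_vars
      exact left_mem_segment _ _ _
    · refine ⟨(x / (x + y), y / (x + y)), ⟨x / (x + y), y / (x + y), by positivity, by positivity,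
        by field_simp, by simp⟩, ⟨1 - (x + y), x + y, by linarith, h.le, by ring, ?_⟩⟩
      ext <;> simp <;> field_simp

theorem isClosed_unitTriangle : IsClosed unitTriangle :=
  (isClosed_le continuous_const continuous_fst).inter
    ((isClosed_le continuous_const continuous_snd).inter
      (isClosed_le (continuous_fst.add continuous_snd) continuous_const))

theorem unitTriangle_subset : unitTriangle ⊆ Icc 0 1 ×ˢ Icc 0 1 := fun _ ⟨h1, h2, h3⟩ =>
  ⟨⟨h1, by linarith⟩, ⟨h2, by linarith⟩⟩

theorem isCompact_unitTriangle : IsCompact unitTriangle :=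
  (isCompact_Icc.prod isCompact_Icc).of_isClosed_subset isClosed_unitTriangle unitTriangle_subset

/-- The reflection of the plane in the line `x + y = 1`. -/
def hypotenuseReflection (p : ℝ × ℝ) : ℝ × ℝ := (1 - p.2, 1 - p.1)

theorem measurePreserving_hypotenuseReflection : MeasurePreserving hypotenuseReflection :=
  ((Measure.measurePreserving_sub_left volume (1 : ℝ)).prod
    (Measure.measurePreserving_sub_left volume (1 : ℝ))).comp Measure.measurePreserving_swap

theorem measurableEmbedding_hypotenuseReflection : MeasurableEmbedding hypotenuseReflection :=
  measurePreserving_hypotenuseReflection.measurable.measurableEmbedding fun p q h => by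
    simp only [hypotenuseReflection, Prod.mk.injEq, sub_right_inj] at h
    exact Prod.ext h.2 h.1

theorem volume_hypotenuse : volume {p : ℝ × ℝ | p.1 + p.2 = 1} = 0 := by
  have hm : MeasurableSet {p : ℝ × ℝ | p.1 + p.2 = 1} :=
    (isClosed_eq (continuous_fst.add continuous_snd) continuous_const).measurableSet
  rw [Measure.volume_eq_prod, Measure.measure_prod_null hm]
  refine ae_of_all _ fun x => ?_
  have : Prod.mk x ⁻¹' {p : ℝ × ℝ | p.1 + p.2 = 1} = {1 - x} := by
    ext y
    simp [eq_sub_iff_add_eq, add_comm]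
  simp [this]

/-- Folding the unit square along its diagonal `x + y = 1`. -/
theorem integral_unit_square_eq {F G : ℝ × ℝ → ℝ} (hF : BoundedMeasurable F)
    (hG : BoundedMeasurable G) :
    ∫ p : ℝ × ℝ, (if p.1 + p.2 ≤ 1 then F p else G (hypotenuseReflection p))
      ∂(unitMeasure.prod unitMeasure) = (∫ p in unitTriangle, F p) + ∫ p in unitTriangle, G p := by
  set L : Set (ℝ × ℝ) := {p | p.1 + p.2 ≤ 1} with hL
  have hLm : MeasurableSet L :=
    (isClosed_le (continuous_fst.add continuous_snd) continuous_const).measurableSet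
  have hGσ := hG.comp measurePreserving_hypotenuseReflection.measurable
  have hprod : unitMeasure.prod unitMeasure
      = (volume : Measure (ℝ × ℝ)).restrict (Icc 0 1 ×ˢ Icc 0 1) := by
    rw [unitMeasure, Measure.prod_restrict, Measure.volume_eq_prod]
  have e1 : L ∩ Icc 0 1 ×ˢ Icc 0 1 = unitTriangle := by
    refine Subset.antisymm (fun p hp => ⟨hp.2.1.1, hp.2.2.1, hp.1⟩) fun p hp =>
      ⟨hp.2.2, unitTriangle_subset hp⟩
  have e2 : Lᶜ ∩ Icc 0 1 ×ˢ Icc 0 1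
      = hypotenuseReflection ⁻¹' (unitTriangle \ {p : ℝ × ℝ | p.1 + p.2 = 1}) := by
    ext ⟨x, y⟩
    simp only [hL, unitTriangle, hypotenuseReflection, mem_inter_iff, mem_compl_iff, mem_ofPred_eq,
      mem_prod, mem_Icc, mem_preimage, mem_sdiff, not_le]
    constructor
    · rintro ⟨h1, ⟨h2, h3⟩, h4, h5⟩
      exact ⟨⟨by linarith, by linarith, by linarith⟩, fun h => by linarith⟩
    · rintro ⟨⟨h1, h2, h3⟩, h4⟩
      have h5 := lt_of_le_of_ne h3 h4
      exact ⟨by linarith, ⟨by linarith, by linarith⟩, by linarith, by linarith⟩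
  have hlow : EqOn (fun p : ℝ × ℝ => if p.1 + p.2 ≤ 1 then F p else G (hypotenuseReflection p))
      F L := fun p hp => if_pos hp
  have hhigh : EqOn (fun p : ℝ × ℝ => if p.1 + p.2 ≤ 1 then F p else G (hypotenuseReflection p))
      (fun p => G (hypotenuseReflection p)) Lᶜ := fun p hp => if_neg hp
  rw [← integral_add_compl hLm]
  · congr 1
    · rw [setIntegral_congr_fun hLm (g := F) hlow, hprod,
        Measure.restrict_restrict hLm, e1]
    · rw [setIntegral_congr_fun hLm.compl (g := fun p => G (hypotenuseReflection p)) hhigh, hprod,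
        Measure.restrict_restrict hLm.compl, e2,
        measurePreserving_hypotenuseReflection.setIntegral_preimage_emb
          measurableEmbedding_hypotenuseReflection]
      exact setIntegral_congr_set (sdiff_null_ae_eq_self volume_hypotenuse)
  · obtain ⟨C, hC⟩ := hF.bounded
    obtain ⟨C', hC'⟩ := hG.bounded
    refine Integrable.of_bound (C := max C C')
      (Measurable.ite hLm hF.measurable hGσ.measurable).aestronglyMeasurable
      (ae_of_all _ fun p => ?_)
    split_ifs
    · exact (hC p).trans (le_max_left _ _)
    · exact (hC' _).trans (le_max_right _ _)

theorem boundedMeasurable_of_hasCompactSupport {f : ℝ × ℝ → ℝ} (hf : Continuous f)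
    (hs : HasCompactSupport f) : BoundedMeasurable f :=
  ⟨hf.measurable, hs.exists_bound_of_continuous hf⟩

/-- The inequality for globally defined functions of compact support. -/
theorem poincare_unitTriangle_of_hasCompactSupport {v : ℝ × ℝ → ℝ} (hv : ContDiff ℝ 1 v)
    (hs : HasCompactSupport v)
    (he1 : ∫ t in (0:ℝ)..1, v (t, 0) = 0) (he2 : ∫ t in (0:ℝ)..1, v (0, t) = 0) :
    ∫ x in unitTriangle, (v x) ^ 2 ≤ (0.24647 : ℝ) ^ 2 *
        ∫ x in unitTriangle, ((fderiv ℝ v x (1, 0)) ^ 2 + (fderiv ℝ v x (0, 1)) ^ 2) := by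
  obtain ⟨K, hK⟩ := hv.lipschitzWith_of_hasCompactSupport hs one_ne_zero
  have hvb := boundedMeasurable_of_hasCompactSupport hv.continuous hs
  have hpartial : ∀ e : ℝ × ℝ, BoundedMeasurable fun p => fderiv ℝ v p e := fun e =>
    boundedMeasurable_of_hasCompactSupport
      ((hv.continuous_fderiv one_ne_zero).clm_apply continuous_const) (hs.fderiv_apply ℝ e)
  have hvd : ∀ p, HasFDerivAt v (fderiv ℝ v p) p := fun p =>
    ((hv.differentiable one_ne_zero) p).hasFDerivAt
  set V : ℝ × ℝ → ℝ := fun p => v (min p.1 (1 - p.2), min p.2 (1 - p.1)) with hV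
  set D : ℝ × ℝ → ℝ := fun p => if p.1 + p.2 ≤ 1 then fderiv ℝ v p (1, 0)
    else -fderiv ℝ v (hypotenuseReflection p) (0, 1) with hD
  have hVc : Continuous V := hv.continuous.comp (by fun_prop)
  have hVlow : ∀ x y, x + y ≤ 1 → V (x, y) = v (x, y) := fun x y h => by
    simp only [hV]; rw [min_eq_left (by linarith), min_eq_left (by linarith)]
  have hVhigh : ∀ x y, 1 ≤ x + y → V (x, y) = v (1 - y, 1 - x) := fun x y h => by
    simp only [hV]; rw [min_eq_right (by linarith), min_eq_right (by linarith)]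
  have hDb : BoundedMeasurable D := by
    have hGσ := (hpartial (0, 1)).comp measurePreserving_hypotenuseReflection.measurable
    obtain ⟨C, hC⟩ := (hpartial (1, 0)).bounded
    obtain ⟨C', hC'⟩ := (hpartial (0, 1)).bounded
    refine ⟨Measurable.ite (isClosed_le (by fun_prop) (by fun_prop)).measurableSet
      (hpartial (1, 0)).measurable hGσ.measurable.neg, max C C', fun p => ?_⟩
    simp only [hD]
    split_ifs
    · exact (hC p).trans (le_max_left _ _)
    · rw [abs_neg]
      exact (hC' _).trans (le_max_right _ _)
  have hmain := poincare_unit_square (V := V) (D := D) (K := K) hVc (hvb.comp (by fun_prop)) hDb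
    (fun x y => by simp only [hV, sub_sub_cancel]; rw [min_comm, min_comm (1 - x)])
    (fun y => by
      have h1 : LipschitzWith 1 fun x : ℝ => (min x (1 - y), min y (1 - x)) := by
        refine LipschitzWith.of_dist_le_mul fun a b => ?_
        rw [NNReal.coe_one, one_mul, Prod.dist_eq]
        simp only [Real.dist_eq]
        refine max_le ?_ ?_
        · exact (abs_min_sub_min_le_max _ _ _ _).trans (by simp)
        · refine (abs_min_sub_min_le_max _ _ _ _).trans ?_
          simp [abs_sub_comm]
      have h2 := hK.comp h1
      rw [mul_one] at h2
      exact h2)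
    (fun x y hxy => by
      rcases lt_or_gt_of_ne hxy with h | h
      · have hev : (fun x => V (x, y)) =ᶠ[nhds x] fun x => v (x, y) := by
          filter_upwards [Iio_mem_nhds h] with z hz
          exact hVlow z y (by linarith [mem_Iio.1 hz])
        refine HasDerivAt.congr_of_eventuallyEq ?_ hev
        simp only [hD]
        rw [if_pos (by linarith)]
        exact (hvd (x, y)).comp_hasDerivAt x ((hasDerivAt_id x).prodMk (hasDerivAt_const x y))
      · have hev : (fun x => V (x, y)) =ᶠ[nhds x] fun x => v (1 - y, 1 - x) := by
          filter_upwards [Ioi_mem_nhds h] with z hz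
          exact hVhigh z y (by linarith [mem_Ioi.1 hz])
        refine HasDerivAt.congr_of_eventuallyEq ?_ hev
        simp only [hD, hypotenuseReflection]
        rw [if_neg (by linarith)]
        refine ((hvd (1 - y, 1 - x)).comp_hasDerivAt x ((hasDerivAt_const x (1 - y)).prodMk
          ((hasDerivAt_id x).const_sub 1))).congr_deriv ?_
        rw [← map_neg]; simp)
    (by
      refine (integral_congr fun y hy => ?_).trans he2
      rw [uIcc_of_le zero_le_one] at hy
      exact hVlow 0 y (by linarith [hy.2]))
    (by
      have := integral_comp_sub_left (a := 0) (b := 1) (fun z => v (z, 0)) 1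
      simp only [sub_self, sub_zero] at this
      refine (integral_congr fun y hy => ?_).trans (this.trans he1)
      rw [uIcc_of_le zero_le_one] at hy
      simpa using hVhigh 1 y (by linarith [hy.1]))
  have hVsq : ∀ p, V p ^ 2 = if p.1 + p.2 ≤ 1 then v p ^ 2 else v (hypotenuseReflection p) ^ 2 := by
    rintro ⟨x, y⟩
    split_ifs with h
    · rw [hVlow x y h]
    · rw [hVhigh x y (not_le.1 h).le, hypotenuseReflection]
  have hDsq : ∀ p, D p ^ 2 = if p.1 + p.2 ≤ 1 then fderiv ℝ v p (1, 0) ^ 2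
      else fderiv ℝ v (hypotenuseReflection p) (0, 1) ^ 2 := by
    intro p
    simp only [hD]
    split_ifs
    · rfl
    · rw [neg_sq]
  simp only [hVsq, hDsq] at hmain
  have hfin : IsFiniteMeasure (volume.restrict unitTriangle) :=
    ⟨by simpa using isCompact_unitTriangle.measure_lt_top⟩
  rw [integral_unit_square_eq (F := fun p => v p ^ 2) (G := fun p => v p ^ 2) hvb.sq hvb.sq,
    integral_unit_square_eq (F := fun p => fderiv ℝ v p (1, 0) ^ 2)
      (G := fun p => fderiv ℝ v p (0, 1) ^ 2) (hpartial _).sq (hpartial _).sq,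
    ← MeasureTheory.integral_add ((hpartial _).sq.integrable _) ((hpartial _).sq.integrable _)]
    at hmain
  calc _ = (0.24647 : ℝ) ^ 2 * ((1 / 0.24647) ^ 2 / 2 * ((∫ p in unitTriangle, v p ^ 2)
        + ∫ p in unitTriangle, v p ^ 2)) := by ring
    _ ≤ _ := by gcongr

/-- A `C¹` function near a compact set agrees near that set with a `C¹` function on the whole space
that has compact support. -/
theorem exists_contDiff_hasCompactSupport_eventuallyEq {T U : Set (ℝ × ℝ)} {v : ℝ × ℝ → ℝ}
    (hT : IsCompact T) (hU : IsOpen U) (hTU : T ⊆ U) (hv : ContDiffOn ℝ 1 v U) :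
    ∃ w : ℝ × ℝ → ℝ, ContDiff ℝ 1 w ∧ HasCompactSupport w ∧ ∀ x ∈ T, w =ᶠ[nhds x] v := by
  obtain ⟨L, hL, hTL, hLU⟩ := exists_compact_between hT hU hTU
  obtain ⟨M, hM, hLM, hMU⟩ := exists_compact_between hL hU hLU
  obtain ⟨χ, hχ, -, hχs, hχ1⟩ := exists_contMDiff_support_eq_eq_one_iff
    (n := ⊤) (modelWithCornersSelf ℝ (ℝ × ℝ))
    (isOpen_interior (s := M)) hL.isClosed hLM
  have hχc : ContDiff ℝ 1 χ := hχ.contDiff.of_le (by simp)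
  have hχt : tsupport χ ⊆ M := by
    rw [tsupport, hχs]
    exact closure_minimal interior_subset hM.isClosed
  have hsupp : HasCompactSupport χ := hM.of_isClosed_subset (isClosed_tsupport _) hχt
  refine ⟨fun x => χ x * v x, ?_, hsupp.mul_right, fun x hx => ?_⟩
  · refine contDiff_iff_contDiffAt.2 fun x => ?_
    by_cases hx : x ∈ U
    · exact hχc.contDiffAt.mul (hv.contDiffAt (hU.mem_nhds hx))
    · have hev : (fun x => χ x * v x) =ᶠ[nhds x] fun _ => 0 := by
        have := notMem_tsupport_iff_eventuallyEq.1 fun h => hx (hMU (hχt h))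
        filter_upwards [this] with y hy
        simp [hy]
      exact contDiffAt_const.congr_of_eventuallyEq hev
  · filter_upwards [mem_interior_iff_mem_nhds.1 (hTL hx)] with y hy
    rw [(hχ1 y).1 hy, one_mul]

/-- On the unit right isosceles triangle `T` (convex hull of `(0,0)`, `(1,0)`, `(0,1)`),
every function `v` that is `C¹` on a neighborhood of `T` and has vanishing mean on
the two legs satisfies the Poincaré-type inequality
`‖v‖² ≤ 0.24647² · |v|₁²`. -/
theorem stmt_4
    (T : Set (ℝ × ℝ))
    (hT : T = convexHull ℝ {((0 : ℝ), (0 : ℝ)), (1, 0), (0, 1)})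
    (v : ℝ × ℝ → ℝ)
    (hv : ∃ U : Set (ℝ × ℝ), IsOpen U ∧ T ⊆ U ∧ ContDiffOn ℝ 1 v U)
    (he1 : ∫ t in (0:ℝ)..1, v (t, 0) = 0)
    (he2 : ∫ t in (0:ℝ)..1, v (0, t) = 0) :
    ∫ x in T, (v x) ^ 2 ≤
      (0.24647 : ℝ) ^ 2 *
        ∫ x in T, ((fderiv ℝ v x (1, 0)) ^ 2 + (fderiv ℝ v x (0, 1)) ^ 2) := by
  rw [convexHull_eq_unitTriangle] at hT
  subst hT
  obtain ⟨U, hU, hTU, hvU⟩ := hv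
  obtain ⟨w, hw, hws, hwv⟩ :=
    exists_contDiff_hasCompactSupport_eventuallyEq isCompact_unitTriangle hU hTU hvU
  have hmeas := isClosed_unitTriangle.measurableSet
  have hleg1 : ∫ t in (0:ℝ)..1, w (t, 0) = 0 := by
    refine (integral_congr fun t ht => ?_).trans he1
    rw [uIcc_of_le zero_le_one] at ht
    exact (hwv (t, 0) ⟨ht.1, le_rfl, by simpa using ht.2⟩).eq_of_nhds
  have hleg2 : ∫ t in (0:ℝ)..1, w (0, t) = 0 := by
    refine (integral_congr fun t ht => ?_).trans he2
    rw [uIcc_of_le zero_le_one] at ht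
    exact (hwv (0, t) ⟨le_rfl, ht.1, by simpa using ht.2⟩).eq_of_nhds
  have h := poincare_unitTriangle_of_hasCompactSupport hw hws hleg1 hleg2
  have hsq : EqOn (fun x => w x ^ 2) (fun x => v x ^ 2) unitTriangle := fun x hx => by
    simp only [(hwv x hx).eq_of_nhds]
  have hgrad : EqOn (fun x => (fderiv ℝ w x (1, 0)) ^ 2 + (fderiv ℝ w x (0, 1)) ^ 2)
      (fun x => (fderiv ℝ v x (1, 0)) ^ 2 + (fderiv ℝ v x (0, 1)) ^ 2) unitTriangle :=
    fun x hx => by simp only [(hwv x hx).fderiv_eq]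
  rwa [setIntegral_congr_fun hmeas hsq, setIntegral_congr_fun hmeas hgrad] at h
end

section
/- Let T be the closed triangle in ℝ² with vertices (0,0), (1,0), (0,1). There exists a function v : ℝ² → ℝ, continuously differentiable on a neighborhood of T, with ∫₀¹ v(t,0) dt = 0, ∫₀¹ v(0,t) dt = 0, ∫_T ((∂v/∂x₁)² + (∂v/∂x₂)²) dx > 0, and ∫_T v² dx > (0.24641)² · ∫_T ((∂v/∂x₁)² + (∂v/∂x₂)²) dx. -/
open MeasureTheory

/-- The standard triangle in coordinates. -/
lemma convexHull_unit_triangle :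
    convexHull ℝ {((0 : ℝ), (0 : ℝ)), (1, 0), (0, 1)} =
      {p : ℝ × ℝ | 0 ≤ p.1 ∧ 0 ≤ p.2 ∧ p.1 + p.2 ≤ 1} := by
  ext ⟨x, y⟩
  simp only [convexHull_insert (Set.insert_nonempty _ _), convexHull_pair, Set.mem_ofPred_eq,
    convexJoin_singleton_left, Set.mem_iUnion, segment, exists_prop]
  constructor
  · rintro ⟨p, ⟨a, b, ha, hb, hab, rfl⟩, c, d, hc, hd, hcd, h⟩
    simp only [Prod.smul_mk, Prod.mk_add_mk, smul_eq_mul, Prod.mk.injEq] at h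
    obtain ⟨rfl, rfl⟩ := h
    refine ⟨by positivity, by positivity, ?_⟩
    have : d * a + d * b = d := by rw [← mul_add, hab, mul_one]
    linarith
  · rintro ⟨hx, hy, hxy⟩
    rcases eq_or_lt_of_le (add_nonneg hx hy) with h | h
    · obtain rfl : x = 0 := by linarith
      obtain rfl : y = 0 := by linarith
      exact ⟨(1, 0), ⟨1, 0, by simp⟩, 1, 0, by simp⟩
    · refine ⟨(x / (x + y), y / (x + y)), ⟨x / (x + y), y / (x + y), by positivity, by positivity,
        by field_simp, by simp⟩, 1 - (x + y), x + y, by linarith, h.le, by ring, ?_⟩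
      ext <;> simp <;> field_simp

/-- Fubini on the standard triangle. -/
lemma setIntegral_unit_triangle {f : ℝ × ℝ → ℝ} (hf : Continuous f) :
    ∫ p in {p : ℝ × ℝ | 0 ≤ p.1 ∧ 0 ≤ p.2 ∧ p.1 + p.2 ≤ 1}, f p =
      ∫ x in (0 : ℝ)..1, ∫ y in (0 : ℝ)..(1 - x), f (x, y) := by
  set S : Set (ℝ × ℝ) := {p | 0 ≤ p.1 ∧ 0 ≤ p.2 ∧ p.1 + p.2 ≤ 1} with hS
  have hclosed : IsClosed S :=
    (isClosed_le continuous_const continuous_fst).inter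
      ((isClosed_le continuous_const continuous_snd).inter
        (isClosed_le (continuous_fst.add continuous_snd) continuous_const))
  have hcompact : IsCompact S := by
    refine (isCompact_Icc (a := ((0 : ℝ), (0 : ℝ))) (b := (1, 1))).of_isClosed_subset hclosed ?_
    rintro ⟨x, y⟩ ⟨hx, hy, hxy⟩
    simp only at hx hy hxy
    exact ⟨⟨hx, hy⟩, ⟨by linarith, by linarith⟩⟩
  have hint : Integrable (S.indicator f) :=
    (integrable_indicator_iff hclosed.measurableSet).2
      (hf.continuousOn.integrableOn_compact hcompact)
  rw [← integral_indicator hclosed.measurableSet, Measure.volume_eq_prod, integral_prod _ hint,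
    intervalIntegral.integral_of_le zero_le_one, ← integral_Icc_eq_integral_Ioc,
    ← integral_indicator measurableSet_Icc]
  congr 1 with x
  by_cases hx : x ∈ Set.Icc (0 : ℝ) 1
  · rw [Set.indicator_of_mem hx, intervalIntegral.integral_of_le (by linarith [hx.2]),
      ← integral_Icc_eq_integral_Ioc, ← integral_indicator measurableSet_Icc]
    congr 1 with y
    have : (x, y) ∈ S ↔ y ∈ Set.Icc 0 (1 - x) := by
      simp only [hS, Set.mem_ofPred_eq, Set.mem_Icc, hx.1, true_and, le_sub_iff_add_le']
    by_cases hy : y ∈ Set.Icc 0 (1 - x)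
    · rw [Set.indicator_of_mem hy, Set.indicator_of_mem (this.2 hy)]
    · rw [Set.indicator_of_notMem hy, Set.indicator_of_notMem (mt this.1 hy)]
  · rw [Set.indicator_of_notMem hx]
    refine integral_eq_zero_of_ae (Filter.Eventually.of_forall fun y ↦ ?_)
    refine Set.indicator_of_notMem (fun h ↦ hx ⟨h.1, ?_⟩) _
    have h₁ := h.2.1
    have h₂ := h.2.2
    simp only at h₁ h₂
    linarith

/-- The derivative of a sum of functions of one variable each. -/
lemma fderiv_add_separated {g : ℝ → ℝ} (hg : Differentiable ℝ g) (p : ℝ × ℝ) (u : ℝ × ℝ) :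
    fderiv ℝ (fun q : ℝ × ℝ ↦ g q.1 + g q.2) p u = deriv g p.1 * u.1 + deriv g p.2 * u.2 := by
  have h₁ := (hg p.1).hasDerivAt.comp_hasFDerivAt p (hasFDerivAt_fst (𝕜 := ℝ))
  have h₂ := (hg p.2).hasDerivAt.comp_hasFDerivAt p (hasFDerivAt_snd (𝕜 := ℝ))
  have h := (h₁.add h₂).fderiv
  change fderiv ℝ (fun q : ℝ × ℝ ↦ g q.1 + g q.2) p = _ at h
  simp [h]

/-- The one-variable profile of the quartic trial function. -/
noncomputable def trialProfile (t : ℝ) : ℝ := 5 * t ^ 4 - 10 * t ^ 3 + 3 * t ^ 2 + 2 * t - 1 / 4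

lemma deriv_trialProfile (t : ℝ) :
    deriv trialProfile t = 20 * t ^ 3 - 30 * t ^ 2 + 6 * t + 2 := by
  have h := (((((hasDerivAt_pow 4 t).const_mul 5).sub ((hasDerivAt_pow 3 t).const_mul 10)).add
    ((hasDerivAt_pow 2 t).const_mul 3)).add ((hasDerivAt_id t).const_mul 2)).sub_const (1 / 4)
  refine (h.congr_deriv ?_).deriv
  norm_num
  ring

lemma contDiff_trialProfile : ContDiff ℝ 1 trialProfile := by
  unfold trialProfile
  fun_prop

/-- Integral from `0` of a polynomial given by its coefficients. -/
lemma integral_sum_fin_mul_pow {n : ℕ} (c : Fin n → ℝ) (s : ℝ) :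
    ∫ t in (0 : ℝ)..s, ∑ i, c i * t ^ (i : ℕ) =
      ∑ i, c i * (s ^ ((i : ℕ) + 1) / ((i : ℕ) + 1)) := by
  rw [intervalIntegral.integral_finsetSum fun i _ ↦
    (by fun_prop : Continuous fun t : ℝ ↦ c i * t ^ (i : ℕ)).intervalIntegrable _ _]
  simp [integral_pow]

lemma integral_trialProfile : ∫ t in (0 : ℝ)..1, trialProfile t = 1 / 4 := by
  have h := integral_sum_fin_mul_pow ![-1 / 4, 2, 3, -10, 5] 1
  simp [Fin.sum_univ_succ] at h
  norm_num at h
  rw [← h]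
  congr 1 with t
  unfold trialProfile
  ring

lemma integral_sq_trial :
    ∫ x in (0 : ℝ)..1, ∫ y in (0 : ℝ)..(1 - x), (trialProfile x + trialProfile y) ^ 2 =
      481 / 2520 := by
  have inner (x : ℝ) : ∫ y in (0 : ℝ)..(1 - x), (trialProfile x + trialProfile y) ^ 2 =
      ∑ i, (![83 / 1260, -1 / 4, 7, 20 / 3, -137 / 2, 136 / 5, 593 / 3, -2202 / 7, 365 / 2,
        -340 / 9] : Fin 10 → ℝ) i * x ^ (i : ℕ) := by
    trans ∫ y in (0 : ℝ)..(1 - x), ∑ i, (![trialProfile x ^ 2 - trialProfile x / 2 + 1 / 16,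
      4 * trialProfile x - 1, 6 * trialProfile x + 5 / 2, -20 * trialProfile x + 17,
      10 * trialProfile x - 67 / 2, -40, 130, -100, 25] : Fin 9 → ℝ) i * y ^ (i : ℕ)
    · congr 1 with y
      simp [Fin.sum_univ_succ, trialProfile]
      ring
    · rw [integral_sum_fin_mul_pow]
      simp [Fin.sum_univ_succ, trialProfile]
      ring
  simp_rw [inner, integral_sum_fin_mul_pow]
  simp [Fin.sum_univ_succ]
  norm_num

lemma integral_sq_deriv_trial :
    ∫ x in (0 : ℝ)..1, ∫ y in (0 : ℝ)..(1 - x),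
      (deriv trialProfile x ^ 2 + deriv trialProfile y ^ 2) = 22 / 7 := by
  have inner (x : ℝ) : ∫ y in (0 : ℝ)..(1 - x),
      (deriv trialProfile x ^ 2 + deriv trialProfile y ^ 2) =
      ∑ i, (![50 / 7, 16, -120, -168, 1490, -2568, 1800, -3200 / 7] :
        Fin 8 → ℝ) i * x ^ (i : ℕ) := by
    trans ∫ y in (0 : ℝ)..(1 - x), ∑ i,
      (![deriv trialProfile x ^ 2 + 4, 24, -84, -280, 1140, -1200, 400] :
      Fin 7 → ℝ) i * y ^ (i : ℕ)
    · congr 1 with y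
      simp [Fin.sum_univ_succ, deriv_trialProfile]
      ring
    · rw [integral_sum_fin_mul_pow]
      simp [Fin.sum_univ_succ, deriv_trialProfile]
      ring
  simp_rw [inner, integral_sum_fin_mul_pow]
  simp [Fin.sum_univ_succ]
  norm_num

/-- On the unit right isosceles triangle `T` (convex hull of `(0,0)`, `(1,0)`, `(0,1)`),
there is a function `v`, `C¹` on a neighborhood of `T`, with vanishing mean on the two
legs, nonzero first seminorm, and `‖v‖² > 0.24641² · |v|₁²`. -/
theorem stmt_5
    (T : Set (ℝ × ℝ))
    (hT : T = convexHull ℝ {((0 : ℝ), (0 : ℝ)), (1, 0), (0, 1)}) :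
    ∃ v : ℝ × ℝ → ℝ,
      (∃ U : Set (ℝ × ℝ), IsOpen U ∧ T ⊆ U ∧ ContDiffOn ℝ 1 v U) ∧
      (∫ t in (0:ℝ)..1, v (t, 0)) = 0 ∧
      (∫ t in (0:ℝ)..1, v (0, t)) = 0 ∧
      0 < ∫ x in T, ((fderiv ℝ v x (1, 0)) ^ 2 + (fderiv ℝ v x (0, 1)) ^ 2) ∧
      (0.24641 : ℝ) ^ 2 *
          (∫ x in T, ((fderiv ℝ v x (1, 0)) ^ 2 + (fderiv ℝ v x (0, 1)) ^ 2)) <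
        ∫ x in T, (v x) ^ 2 := by
  have hg := contDiff_trialProfile
  have hg' := hg.differentiable one_ne_zero
  have hleg : ∫ t in (0 : ℝ)..1, (trialProfile t + trialProfile 0) = 0 := by
    rw [intervalIntegral.integral_add (hg.continuous.intervalIntegrable _ _) (by simp),
      integral_trialProfile]
    norm_num [trialProfile]
  rw [hT, convexHull_unit_triangle]
  refine ⟨fun q ↦ trialProfile q.1 + trialProfile q.2,
    ⟨Set.univ, isOpen_univ, Set.subset_univ _, by fun_prop⟩, hleg,
    by simpa only [add_comm] using hleg, ?_⟩
  have hcont := hg.continuous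
  have hcont' := hg.continuous_deriv_one
  simp only [fderiv_add_separated hg', mul_one, mul_zero, add_zero, zero_add]
  rw [setIntegral_unit_triangle (by fun_prop), setIntegral_unit_triangle (by fun_prop),
    integral_sq_trial, integral_sq_deriv_trial]
  norm_num
end

section
/- Let K be a nondegenerate closed triangle in ℝ² with vertices P₁, P₂, P₃, and let C > 0 be a constant such that every function w : ℝ² → ℝ continuously differentiable on a neighborhood of K with ∫_K w dx = 0 satisfies ∫_K w² dx ≤ C² ∫_K ((∂w/∂x₁)² + (∂w/∂x₂)²) dx. Then every function v : ℝ² → ℝ twice continuously differentiable on a neighborhood of K whose line integral along each edge vanishes (∫₀¹ v((1−t)Pᵢ + t·Pⱼ) dt = 0 for each edge PᵢPⱼ) satisfies ∫_K ((∂v/∂x₁)² + (∂v/∂x₂)²) dx ≤ C² ∫_K ((∂²v/∂x₁²)² + 2(∂²v/∂x₁∂x₂)² + (∂²v/∂x₂²)²) dx. -/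
open MeasureTheory

/-- The reference triangle with vertices `(0, 0)`, `(1, 0)` and `(0, 1)`. -/
def refTriangle : Set (ℝ × ℝ) := {p | 0 ≤ p.1 ∧ 0 ≤ p.2 ∧ p.1 + p.2 ≤ 1}

theorem isCompact_refTriangle : IsCompact refTriangle := by
  refine (isCompact_Icc (a := ((0, 0) : ℝ × ℝ)) (b := (1, 1))).of_isClosed_subset ?_ ?_
  · exact (isClosed_le continuous_const continuous_fst).inter
      ((isClosed_le continuous_const continuous_snd).inter
        (isClosed_le (continuous_fst.add continuous_snd) continuous_const))
  · rintro ⟨x, y⟩ ⟨h₁, h₂, h₃⟩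
    simp only at h₁ h₂ h₃
    exact ⟨⟨h₁, h₂⟩, ⟨by simp only; linarith, by simp only; linarith⟩⟩

theorem setIntegral_refTriangle {F : ℝ × ℝ → ℝ} (hF : ContinuousOn F refTriangle) :
    ∫ p in refTriangle, F p = ∫ s in (0:ℝ)..1, ∫ t in (0:ℝ)..(1 - s), F (s, t) := by
  have hm := isCompact_refTriangle.isClosed.measurableSet
  have hint : Integrable (refTriangle.indicator F) (volume.prod volume) :=
    (hF.integrableOn_compact isCompact_refTriangle).integrable_indicator hm
  rw [← integral_indicator hm, Measure.volume_eq_prod, integral_prod _ hint,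
    intervalIntegral.integral_of_le zero_le_one, ← integral_Icc_eq_integral_Ioc,
    ← integral_indicator measurableSet_Icc]
  congr 1 with s
  by_cases hs : s ∈ Set.Icc (0:ℝ) 1
  · rw [Set.indicator_of_mem hs, intervalIntegral.integral_of_le (by linarith [hs.2]),
      ← integral_Icc_eq_integral_Ioc, ← integral_indicator measurableSet_Icc]
    congr 1 with t
    have hiff : (s, t) ∈ refTriangle ↔ t ∈ Set.Icc 0 (1 - s) :=
      ⟨fun h => ⟨h.2.1, le_sub_iff_add_le'.2 h.2.2⟩,
        fun h => ⟨hs.1, h.1, le_sub_iff_add_le'.1 h.2⟩⟩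
    simp only [Set.indicator, hiff]
  · rw [Set.indicator_of_notMem hs]
    have hzero : ∀ t, refTriangle.indicator F (s, t) = 0 := fun t =>
      Set.indicator_of_notMem (fun h => hs ⟨h.1, by
        have h₂ := h.2.1
        have h₃ := h.2.2
        simp only at h₂ h₃
        linarith⟩) F
    simp [hzero]

/-- The linear part of the affine parametrization of a triangle with edge vectors `u`, `w`. -/
noncomputable def edgeMap (u w : ℝ × ℝ) : ℝ × ℝ →L[ℝ] ℝ × ℝ :=
  (ContinuousLinearMap.fst ℝ ℝ ℝ).smulRight u + (ContinuousLinearMap.snd ℝ ℝ ℝ).smulRight w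

@[simp] theorem edgeMap_apply (u w p : ℝ × ℝ) : edgeMap u w p = p.1 • u + p.2 • w := by
  simp [edgeMap]

theorem edgeMap_injective {u w : ℝ × ℝ} (h : u.1 * w.2 - u.2 * w.1 ≠ 0) :
    Function.Injective (edgeMap u w) := by
  refine (injective_iff_map_eq_zero _).2 fun p hp => ?_
  simp only [edgeMap_apply, Prod.ext_iff, Prod.fst_add, Prod.snd_add, Prod.smul_fst,
    Prod.smul_snd, smul_eq_mul, Prod.fst_zero, Prod.snd_zero] at hp
  ext
  · exact (mul_eq_zero.1 (show p.1 * (u.1 * w.2 - u.2 * w.1) = 0 by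
      linear_combination w.2 * hp.1 - w.1 * hp.2)).resolve_right h
  · exact (mul_eq_zero.1 (show p.2 * (u.1 * w.2 - u.2 * w.1) = 0 by
      linear_combination u.1 * hp.2 - u.2 * hp.1)).resolve_right h

theorem convexHull_eq_image_refTriangle (P₁ P₂ P₃ : ℝ × ℝ) :
    convexHull ℝ {P₁, P₂, P₃} =
      (fun p => P₁ + edgeMap (P₂ - P₁) (P₃ - P₁) p) '' refTriangle := by
  have hconv : Convex ℝ refTriangle := by
    rintro p ⟨h₁, h₂, h₃⟩ q ⟨k₁, k₂, k₃⟩ a b ha hb hab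
    refine ⟨?_, ?_, ?_⟩ <;> simp only [Prod.fst_add, Prod.snd_add, Prod.smul_fst, Prod.smul_snd,
      smul_eq_mul]
    · positivity
    · positivity
    · nlinarith [mul_le_mul_of_nonneg_left h₃ ha, mul_le_mul_of_nonneg_left k₃ hb]
  apply Set.Subset.antisymm
  · refine convexHull_min ?_ ?_
    · rintro P (rfl | rfl | rfl)
      · exact ⟨(0, 0), by simp [refTriangle], by simp⟩
      · exact ⟨(1, 0), by simp [refTriangle], by simp⟩
      · exact ⟨(0, 1), by simp [refTriangle], by simp⟩
    · rw [← Set.image_image (fun q => P₁ + q)]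
      exact (hconv.linear_image (edgeMap (P₂ - P₁) (P₃ - P₁)).toLinearMap).translate P₁
  · rintro _ ⟨⟨s, t⟩, ⟨h₁, h₂, h₃⟩, rfl⟩
    simp only at h₁ h₂ h₃
    have hsub := subset_convexHull ℝ ({P₁, P₂, P₃} : Set (ℝ × ℝ))
    have hmem := (convex_convexHull ℝ ({P₁, P₂, P₃} : Set (ℝ × ℝ))).sum_mem
      (t := Finset.univ) (w := ![1 - s - t, s, t]) (z := ![P₁, P₂, P₃])
      (by intro i _; fin_cases i <;> simp <;> linarith)
      (by simp only [Fin.sum_univ_three, Matrix.cons_val]; ring)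
      (by intro i _; fin_cases i <;> exact hsub (by simp))
    convert hmem using 1
    simp only [Fin.sum_univ_three, edgeMap_apply, Matrix.cons_val]
    module

theorem cross_ne_zero_of_not_collinear {P₁ P₂ P₃ : ℝ × ℝ} (hP : ¬ Collinear ℝ {P₁, P₂, P₃}) :
    (P₂ - P₁).1 * (P₃ - P₁).2 - (P₂ - P₁).2 * (P₃ - P₁).1 ≠ 0 := by
  intro h
  obtain ⟨u, hu⟩ : ∃ u, u = P₂ - P₁ := ⟨_, rfl⟩
  obtain ⟨w, hw⟩ : ∃ w, w = P₃ - P₁ := ⟨_, rfl⟩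
  rw [← hu, ← hw] at h
  have hdep : ∃ (z : ℝ × ℝ) (a b : ℝ), u = a • z ∧ w = b • z := by
    by_cases h₁ : u.1 = 0
    · by_cases h₂ : u.2 = 0
      · exact ⟨w, 0, 1, by ext <;> simp [h₁, h₂], by simp⟩
      · refine ⟨u, 1, w.2 / u.2, by simp, ?_⟩
        ext
        · simp only [Prod.smul_fst, smul_eq_mul]
          field_simp
          linarith
        · simp only [Prod.smul_snd, smul_eq_mul]
          field_simp
    · refine ⟨u, 1, w.1 / u.1, by simp, ?_⟩
      ext
      · simp only [Prod.smul_fst, smul_eq_mul]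
        field_simp
      · simp only [Prod.smul_snd, smul_eq_mul]
        field_simp
        linarith
  obtain ⟨z, a, b, ha, hb⟩ := hdep
  refine hP ((collinear_iff_of_mem (p₀ := P₁) (by simp)).2 ⟨z, ?_⟩)
  rintro P (rfl | rfl | rfl)
  · exact ⟨0, by simp⟩
  · exact ⟨a, by rw [← ha, hu]; simp⟩
  · exact ⟨b, by rw [← hb, hw]; simp⟩

/-- The mean over a triangle of the derivative along an edge vanishes if the integrals over the
other two edges do. -/
theorem setIntegral_fderiv_edge_eq_zero {P₁ P₂ P₃ : ℝ × ℝ}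
    (hP : ¬ Collinear ℝ {P₁, P₂, P₃}) {U : Set (ℝ × ℝ)} (hU : IsOpen U)
    (hKU : convexHull ℝ {P₁, P₂, P₃} ⊆ U) {v : ℝ × ℝ → ℝ} (hv : ContDiffOn ℝ 1 v U)
    (h₁₂ : (∫ t in (0:ℝ)..1, v ((1 - t) • P₁ + t • P₂)) = 0)
    (h₃₂ : (∫ t in (0:ℝ)..1, v ((1 - t) • P₃ + t • P₂)) = 0) :
    ∫ x in convexHull ℝ {P₁, P₂, P₃}, fderiv ℝ v x (P₃ - P₁) = 0 := by
  set L := edgeMap (P₂ - P₁) (P₃ - P₁) with hL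
  have hK := convexHull_eq_image_refTriangle P₁ P₂ P₃
  have hmem : ∀ p ∈ refTriangle, P₁ + L p ∈ U := fun p hp => hKU (hK ▸ ⟨p, hp, rfl⟩)
  have hA : Continuous fun p => P₁ + L p := by fun_prop
  have hD : ContinuousOn (fun x => fderiv ℝ v x (P₃ - P₁)) U :=
    (hv.continuousOn_fderiv_of_isOpen hU le_rfl).clm_apply continuousOn_const
  have hDA : ContinuousOn (fun p => fderiv ℝ v (P₁ + L p) (P₃ - P₁)) refTriangle :=
    hD.comp hA.continuousOn hmem
  rw [hK, integral_image_eq_integral_abs_det_fderiv_smul volume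
    isCompact_refTriangle.isClosed.measurableSet
    (fun p _ => (L.hasFDerivAt.const_add P₁).hasFDerivWithinAt)
    (((add_right_injective P₁).comp
      (edgeMap_injective (cross_ne_zero_of_not_collinear hP))).injOn)]
  rw [integral_smul, setIntegral_refTriangle hDA]
  have hinner : ∀ s ∈ Set.uIcc (0:ℝ) 1,
      (∫ t in (0:ℝ)..(1 - s), fderiv ℝ v (P₁ + L (s, t)) (P₃ - P₁)) =
        v ((1 - s) • P₃ + s • P₂) - v ((1 - s) • P₁ + s • P₂) := by
    intro s hs
    rw [Set.uIcc_of_le zero_le_one] at hs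
    have hline : ∀ t ∈ Set.uIcc 0 (1 - s), (s, t) ∈ refTriangle := by
      intro t ht
      rw [Set.uIcc_of_le (by linarith [hs.2])] at ht
      exact ⟨hs.1, ht.1, le_sub_iff_add_le'.1 ht.2⟩
    have hderiv : ∀ t ∈ Set.uIcc 0 (1 - s),
        HasDerivAt (fun t => v (P₁ + L (s, t))) (fderiv ℝ v (P₁ + L (s, t)) (P₃ - P₁)) t := by
      intro t ht
      have hx := hmem _ (hline t ht)
      have hvx : HasFDerivAt v (fderiv ℝ v (P₁ + L (s, t))) (P₁ + L (s, t)) :=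
        ((hv.contDiffAt (hU.mem_nhds hx)).differentiableAt one_ne_zero).hasFDerivAt
      refine hvx.comp_hasDerivAt t ?_
      simp only [hL, edgeMap_apply]
      simpa using (((hasDerivAt_id t).smul_const (P₃ - P₁)).const_add
        (s • (P₂ - P₁))).const_add P₁
    rw [intervalIntegral.integral_eq_sub_of_hasDerivAt hderiv]
    · simp only [hL, edgeMap_apply]
      congr 2 <;> module
    · exact (hDA.comp (by fun_prop) hline).intervalIntegrable
  have hedge : ∀ P ∈ ({P₁, P₂, P₃} : Set (ℝ × ℝ)),
      IntervalIntegrable (fun s => v ((1 - s) • P + s • P₂)) volume 0 1 := by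
    intro P hPm
    refine (hv.continuousOn.comp (by fun_prop) fun s hs => hKU ?_).intervalIntegrable
    rw [Set.uIcc_of_le zero_le_one] at hs
    exact convex_convexHull ℝ _ (subset_convexHull ℝ _ hPm) (subset_convexHull ℝ _ (by simp))
      (sub_nonneg.2 hs.2) hs.1 (by ring)
  rw [intervalIntegral.integral_congr hinner,
    intervalIntegral.integral_sub (hedge P₃ (by simp)) (hedge P₁ (by simp)), h₁₂, h₃₂]
  simp

theorem setIntegral_fderiv_eq_zero {P₁ P₂ P₃ : ℝ × ℝ}
    (hP : ¬ Collinear ℝ {P₁, P₂, P₃}) {U : Set (ℝ × ℝ)} (hU : IsOpen U)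
    (hKU : convexHull ℝ {P₁, P₂, P₃} ⊆ U) {v : ℝ × ℝ → ℝ} (hv : ContDiffOn ℝ 1 v U)
    (h₁₂ : (∫ t in (0:ℝ)..1, v ((1 - t) • P₁ + t • P₂)) = 0)
    (h₁₃ : (∫ t in (0:ℝ)..1, v ((1 - t) • P₁ + t • P₃)) = 0)
    (h₂₃ : (∫ t in (0:ℝ)..1, v ((1 - t) • P₂ + t • P₃)) = 0) (e : ℝ × ℝ) :
    ∫ x in convexHull ℝ {P₁, P₂, P₃}, fderiv ℝ v x e = 0 := by
  have h₃₂ : (∫ t in (0:ℝ)..1, v ((1 - t) • P₃ + t • P₂)) = 0 := by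
    have h := intervalIntegral.integral_comp_sub_left (a := 0) (b := 1)
      (fun t => v ((1 - t) • P₂ + t • P₃)) 1
    simp only [sub_self, sub_zero, h₂₃, sub_sub_cancel] at h
    simpa only [add_comm] using h
  have hw := setIntegral_fderiv_edge_eq_zero hP hU hKU hv h₁₂ h₃₂
  have hswap : ({P₁, P₃, P₂} : Set (ℝ × ℝ)) = {P₁, P₂, P₃} := by rw [Set.pair_comm]
  have hu := setIntegral_fderiv_edge_eq_zero (P₂ := P₃) (P₃ := P₂) (by rwa [hswap]) hU
    (by rwa [hswap]) hv h₁₃ h₂₃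
  rw [hswap] at hu
  have hcompact : IsCompact (convexHull ℝ {P₁, P₂, P₃}) :=
    (Set.toFinite _).isCompact_convexHull ℝ
  have hint : ∀ d, IntegrableOn (fun x => fderiv ℝ v x d) (convexHull ℝ {P₁, P₂, P₃}) :=
    fun d => (((hv.continuousOn_fderiv_of_isOpen hU le_rfl).clm_apply
      continuousOn_const).mono hKU).integrableOn_compact hcompact
  obtain ⟨p, rfl⟩ := (LinearMap.injective_iff_surjective
    (f := (edgeMap (P₂ - P₁) (P₃ - P₁)).toLinearMap)).1
    (edgeMap_injective (cross_ne_zero_of_not_collinear hP)) e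
  simp only [ContinuousLinearMap.coe_coe, edgeMap_apply, map_add, map_smul]
  refine (integral_add ((hint _).smul p.1) ((hint _).smul p.2)).trans ?_
  simp only [Pi.smul_apply, integral_smul, hu, hw, smul_zero, add_zero]

/-- If `C > 0` is an upper bound for the mean-zero Poincaré constant of the
nondegenerate triangle `K` (for functions `C¹` near `K`), then every `v` that is `C²`
near `K` with vanishing line integral along each edge satisfies `|v|₁ ≤ C·|v|₂`,
i.e. `|v|₁² ≤ C²·|v|₂²`. -/
theorem stmt_7
    (P₁ P₂ P₃ : ℝ × ℝ) (hP : ¬ Collinear ℝ {P₁, P₂, P₃})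
    (K : Set (ℝ × ℝ)) (hK : K = convexHull ℝ {P₁, P₂, P₃})
    (C : ℝ) (hC : 0 < C)
    (hPoincare : ∀ w : ℝ × ℝ → ℝ,
      (∃ U : Set (ℝ × ℝ), IsOpen U ∧ K ⊆ U ∧ ContDiffOn ℝ 1 w U) →
      (∫ x in K, w x) = 0 →
      ∫ x in K, (w x) ^ 2 ≤
        C ^ 2 * ∫ x in K, ((fderiv ℝ w x (1, 0)) ^ 2 + (fderiv ℝ w x (0, 1)) ^ 2)) :
    ∀ v : ℝ × ℝ → ℝ,
      (∃ U : Set (ℝ × ℝ), IsOpen U ∧ K ⊆ U ∧ ContDiffOn ℝ 2 v U) →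
      (∫ t in (0:ℝ)..1, v ((1 - t) • P₁ + t • P₂)) = 0 →
      (∫ t in (0:ℝ)..1, v ((1 - t) • P₁ + t • P₃)) = 0 →
      (∫ t in (0:ℝ)..1, v ((1 - t) • P₂ + t • P₃)) = 0 →
      ∫ x in K, ((fderiv ℝ v x (1, 0)) ^ 2 + (fderiv ℝ v x (0, 1)) ^ 2) ≤
        C ^ 2 * ∫ x in K,
          ((fderiv ℝ (fun y => fderiv ℝ v y (1, 0)) x (1, 0)) ^ 2 +
            2 * (fderiv ℝ (fun y => fderiv ℝ v y (1, 0)) x (0, 1)) ^ 2 +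
            (fderiv ℝ (fun y => fderiv ℝ v y (0, 1)) x (0, 1)) ^ 2) := by
  rintro v ⟨U, hU, hKU, hv⟩ h₁₂ h₁₃ h₂₃
  have hKc : IsCompact K := hK ▸ (Set.toFinite _).isCompact_convexHull ℝ
  have hD : ∀ e, ContDiffOn ℝ 1 (fun y => fderiv ℝ v y e) U := fun e =>
    (hv.fderiv_of_isOpen hU (by norm_num)).clm_apply contDiffOn_const
  have hcont : ∀ e, ContinuousOn (fun y => fderiv ℝ v y e) K := fun e =>
    (hD e).continuousOn.mono hKU
  have hcont₂ : ∀ e d, ContinuousOn (fun x => fderiv ℝ (fun y => fderiv ℝ v y e) x d) K :=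
    fun e d => (((hD e).continuousOn_fderiv_of_isOpen hU le_rfl).clm_apply
      continuousOn_const).mono hKU
  have hpoin : ∀ e, ∫ x in K, (fderiv ℝ v x e) ^ 2 ≤ C ^ 2 * ∫ x in K,
      ((fderiv ℝ (fun y => fderiv ℝ v y e) x (1, 0)) ^ 2 +
        (fderiv ℝ (fun y => fderiv ℝ v y e) x (0, 1)) ^ 2) := fun e =>
    hPoincare _ ⟨U, hU, hKU, hD e⟩ <| by
      subst hK
      exact setIntegral_fderiv_eq_zero hP hU hKU (hv.of_le (by norm_num)) h₁₂ h₁₃ h₂₃ e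
  have hsymm : ∀ x ∈ K, fderiv ℝ (fun y => fderiv ℝ v y (0, 1)) x (1, 0) =
      fderiv ℝ (fun y => fderiv ℝ v y (1, 0)) x (0, 1) := by
    intro x hx
    have hvx := hv.contDiffAt (hU.mem_nhds (hKU hx))
    have hd : DifferentiableAt ℝ (fderiv ℝ v) x :=
      (hvx.fderiv_right (m := 1) (by norm_num)).differentiableAt one_ne_zero
    have happ : ∀ e d, fderiv ℝ (fun y => fderiv ℝ v y e) x d = fderiv ℝ (fderiv ℝ v) x d e := by
      intro e d
      rw [fderiv_clm_apply hd (differentiableAt_const e)]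
      simp
    rw [happ, happ]
    exact (hvx.isSymmSndFDerivAt (by simp)).eq _ _
  have hint : ∀ e, IntegrableOn (fun x => (fderiv ℝ v x e) ^ 2) K := fun e =>
    ((hcont e).pow 2).integrableOn_compact hKc
  have hint₂ : ∀ e, IntegrableOn (fun x => (fderiv ℝ (fun y => fderiv ℝ v y e) x (1, 0)) ^ 2 +
      (fderiv ℝ (fun y => fderiv ℝ v y e) x (0, 1)) ^ 2) K := fun e =>
    (((hcont₂ e _).pow 2).add ((hcont₂ e _).pow 2)).integrableOn_compact hKc
  rw [integral_add (hint _) (hint _)]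
  refine (add_le_add (hpoin (1, 0)) (hpoin (0, 1))).trans_eq ?_
  rw [← mul_add, ← integral_add (hint₂ _) (hint₂ _)]
  congr 1
  refine setIntegral_congr_fun hKc.isClosed.measurableSet fun x hx => ?_
  simp only [hsymm x hx]
  ring
end

section
/- Let x₁, x₂, x₃ be three non-collinear points in ℝ², let g = (x₁ + x₂ + x₃)/3 be their centroid, and define φ : ℝ² → ℝ by φ(x) = (1/2)‖x − g‖² − (1/12)(‖x₁ − g‖² + ‖x₂ − g‖² + ‖x₃ − g‖²). Then for every pair of distinct indices i, j ∈ {1,2,3}, ∫₀¹ φ((1−t)·xᵢ + t·xⱼ) dt = 0; that is, the line integral of φ along each edge of the triangle vanishes. -/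
open MeasureTheory

section Segment

variable {E : Type*} [NormedAddCommGroup E] [InnerProductSpace ℝ E]

theorem norm_sq_one_sub_smul_add_smul (a b : E) (t : ℝ) :
    ‖(1 - t) • a + t • b‖ ^ 2 =
      ‖a‖ ^ 2 + t * (2 * (inner ℝ a b - ‖a‖ ^ 2)) +
        t ^ 2 * (‖a‖ ^ 2 - 2 * inner ℝ a b + ‖b‖ ^ 2) := by
  rw [norm_add_sq_real, norm_smul, norm_smul, mul_pow, mul_pow, Real.norm_eq_abs,
    Real.norm_eq_abs, sq_abs, sq_abs, real_inner_smul_left, real_inner_smul_right]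
  ring

theorem integral_norm_sq_segment (a b : E) :
    ∫ t in (0 : ℝ)..1, ‖(1 - t) • a + t • b‖ ^ 2 =
      (‖a‖ ^ 2 + inner ℝ a b + ‖b‖ ^ 2) / 3 := by
  simp_rw [norm_sq_one_sub_smul_add_smul]
  rw [intervalIntegral.integral_add (Continuous.intervalIntegrable (by fun_prop) _ _)
      (Continuous.intervalIntegrable (by fun_prop) _ _),
    intervalIntegral.integral_add (Continuous.intervalIntegrable (by fun_prop) _ _)
      (Continuous.intervalIntegrable (by fun_prop) _ _),
    intervalIntegral.integral_const, intervalIntegral.integral_mul_const,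
    intervalIntegral.integral_mul_const, integral_id, integral_pow, smul_eq_mul]
  norm_num
  ring

/-- The quadratic bubble centred at the barycenter `g` of `a`, `b`, `c` has vanishing integral
along the edge from `a` to `b`. -/
theorem integral_quadratic_bubble_segment {a b c g : E} (hg : g = (3 : ℝ)⁻¹ • (a + b + c)) :
    ∫ t in (0 : ℝ)..1, ((1 / 2) * ‖(1 - t) • a + t • b - g‖ ^ 2 -
      (1 / 12) * (‖a - g‖ ^ 2 + ‖b - g‖ ^ 2 + ‖c - g‖ ^ 2)) = 0 := by
  have hc : c - g = -((a - g) + (b - g)) := by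
    rw [hg]; module
  have hseg (t : ℝ) : (1 - t) • a + t • b - g = (1 - t) • (a - g) + t • (b - g) := by
    module
  simp_rw [hseg]
  rw [intervalIntegral.integral_sub (Continuous.intervalIntegrable (by fun_prop) _ _)
      (Continuous.intervalIntegrable (by fun_prop) _ _),
    intervalIntegral.integral_const_mul, integral_norm_sq_segment,
    intervalIntegral.integral_const, hc, norm_neg, norm_add_sq_real, smul_eq_mul]
  ring

end Segment

/-- The non-conforming quadratic bubble function
`φ(x) = ½‖x−g‖² − (1/12)·Σᵢ‖xᵢ−g‖²` of a nondegenerate triangle with vertices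
`x₁, x₂, x₃` and barycenter `g` has vanishing line integral along each edge. -/
theorem stmt_9
    (p : Fin 3 → EuclideanSpace ℝ (Fin 2))
    (hp : ¬ Collinear ℝ (Set.range p))
    (g : EuclideanSpace ℝ (Fin 2)) (hg : g = (3 : ℝ)⁻¹ • (p 0 + p 1 + p 2))
    (φ : EuclideanSpace ℝ (Fin 2) → ℝ)
    (hφ : ∀ x, φ x = (1 / 2) * ‖x - g‖ ^ 2 -
      (1 / 12) * (‖p 0 - g‖ ^ 2 + ‖p 1 - g‖ ^ 2 + ‖p 2 - g‖ ^ 2)) :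
    ∀ i j : Fin 3, i ≠ j → (∫ t in (0:ℝ)..1, φ ((1 - t) • p i + t • p j)) = 0 := by
  intro i j hij
  obtain ⟨k, hki, hkj⟩ : ∃ k : Fin 3, k ≠ i ∧ k ≠ j := by
    revert i j; decide
  have hsum {M : Type} [AddCommMonoid M] (f : Fin 3 → M) :
      f 0 + f 1 + f 2 = f i + f j + f k := by
    fin_cases i <;> fin_cases j <;> fin_cases k <;> first | contradiction | rfl | (dsimp; abel)
  simp_rw [hφ, hsum fun l => ‖p l - g‖ ^ 2]
  exact integral_quadratic_bubble_segment (hg.trans (by rw [hsum p]))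
end
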